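/- arXiv:2510.17091 — 2 statements merged into one kernel-verified Lean document; each statement's English description precedes it below -/
import Mathlib

section
/- Fix an integer n ≥ 1 and a constant C₁ > 0. There exist constants δ > 1, c > 0 and C ≥ 1, depending only on n and C₁, such that the following holds. Let B₁ = ∏_{i=1}^n (−a_i, a_i) and B₂ = ∏_{i=1}^n (−b_i, b_i) be boxes in ℝⁿ with B₁ ⊆ B₂, and suppose both that 1/a_i² − 1/b_i² ≤ C₁/(max_j b_j²) for every i, and that a_i ≥ b_i/δ for every i. Then for every open connected set U with B₁ ⊆ U ⊆ B₂, every principal Dirichlet eigenfunction φ_U of U satisfies c·φ_{B₁}(x) ≤ φ_U(x) ≤ C·φ_{B₁}(x) for every x = (x₁,…,x_n) with |x_i| < a_i − (b_i − a_i) for all i, where φ_{B₁}(x) = ∏_{i=1}^n a_i^{−1/2} cos(π x_i/(2 a_i)). -/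
open Real MeasureTheory

noncomputable def dirichletEigenvalue (n : ℕ) (U : Set (EuclideanSpace ℝ (Fin n))) : ℝ :=
  sInf {R : ℝ | ∃ f : EuclideanSpace ℝ (Fin n) → ℝ,
    ContDiff ℝ (⊤ : ℕ∞) f ∧ HasCompactSupport f ∧ tsupport f ⊆ U ∧ f ≠ 0 ∧
    R = (∫ x, ‖fderiv ℝ f x‖ ^ 2) / (∫ x, (f x) ^ 2)}

/-- The Laplacian as the sum of the unmixed second partial derivatives. -/
noncomputable def laplacian {n : ℕ} (φ : EuclideanSpace ℝ (Fin n) → ℝ)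
    (x : EuclideanSpace ℝ (Fin n)) : ℝ :=
  ∑ i : Fin n, fderiv ℝ (fun y => fderiv ℝ φ y (EuclideanSpace.single i 1)) x
    (EuclideanSpace.single i 1)

/-- `φ` is a principal Dirichlet eigenfunction of the nonempty bounded open set `U`. -/
structure IsPrincipalDirichletEigenfunction {n : ℕ} (U : Set (EuclideanSpace ℝ (Fin n)))
    (φ : EuclideanSpace ℝ (Fin n) → ℝ) : Prop where
  continuousOn : ContinuousOn φ (closure U)
  smooth : ContDiffOn ℝ (⊤ : ℕ∞) φ U
  pos : ∀ x ∈ U, 0 < φ x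
  vanishes : ∀ x ∈ frontier U, φ x = 0
  eigenEq : ∀ x ∈ U, laplacian φ x = -(dirichletEigenvalue n U) * φ x
  normalized : (∫ x in U, (φ x) ^ 2) = 1

/-- The open box `∏ i (-a i, a i)` in `ℝⁿ`. -/
def box (n : ℕ) (a : Fin n → ℝ) : Set (EuclideanSpace ℝ (Fin n)) := {x | ∀ i, |x i| < a i}

/-- The principal Dirichlet eigenfunction of the box `∏ i (-a i, a i)`. -/
noncomputable def boxEigenfunction (n : ℕ) (a : Fin n → ℝ)
    (x : EuclideanSpace ℝ (Fin n)) : ℝ :=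
  ∏ i, (1 / Real.sqrt (a i)) * Real.cos (π * x i / (2 * a i))


open Set Filter Topology

section Laplacian

variable {n : ℕ}

lemma eventually_deriv_line {f : EuclideanSpace ℝ (Fin n) → ℝ} {x : EuclideanSpace ℝ (Fin n)}
    (hf : ContDiffAt ℝ 2 f x) (e : EuclideanSpace ℝ (Fin n)) :
    deriv (fun s : ℝ => f (x + s • e)) =ᶠ[𝓝 0] fun s => fderiv ℝ f (x + s • e) e := by
  have hline : Tendsto (fun s : ℝ => x + s • e) (𝓝 0) (𝓝 x) := by
    have : Continuous fun s : ℝ => x + s • e := by fun_prop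
    simpa using this.tendsto 0
  filter_upwards [hline.eventually (hf.eventually (by simp))] with s hs
  have h1 : HasFDerivAt f (fderiv ℝ f (x + s • e)) (x + s • e) :=
    (hs.differentiableAt (by norm_num)).hasFDerivAt
  have h2 : HasDerivAt (fun s : ℝ => x + s • e) e s := by
    simpa using ((hasDerivAt_id s).smul_const e).const_add x
  exact (h1.comp_hasDerivAt s h2).deriv

lemma fderiv_fderiv_eq_deriv_deriv {f : EuclideanSpace ℝ (Fin n) → ℝ}
    {x : EuclideanSpace ℝ (Fin n)} (hf : ContDiffAt ℝ 2 f x) (e : EuclideanSpace ℝ (Fin n)) :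
    fderiv ℝ (fun y => fderiv ℝ f y e) x e = deriv (deriv fun s : ℝ => f (x + s • e)) 0 := by
  rw [(eventually_deriv_line hf e).deriv_eq]
  have h1 : DifferentiableAt ℝ (fderiv ℝ f) x :=
    (hf.fderiv_right (m := 1) (by norm_num)).differentiableAt (by norm_num)
  have h2 : HasFDerivAt (fun y => fderiv ℝ f y e) (fderiv ℝ (fun y => fderiv ℝ f y e) x)
      (x + (0 : ℝ) • e) := by
    simpa using (h1.clm_apply (differentiableAt_const e)).hasFDerivAt
  have h3 : HasDerivAt (fun s : ℝ => x + s • e) e 0 := by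
    simpa using ((hasDerivAt_id (0 : ℝ)).smul_const e).const_add x
  exact (h2.comp_hasDerivAt (0 : ℝ) h3).deriv.symm

lemma laplacian_eq_sum_deriv_deriv {f : EuclideanSpace ℝ (Fin n) → ℝ}
    {x : EuclideanSpace ℝ (Fin n)} (hf : ContDiffAt ℝ 2 f x) :
    laplacian f x =
      ∑ i, deriv (deriv fun s : ℝ => f (x + s • EuclideanSpace.single i 1)) 0 :=
  Finset.sum_congr rfl fun _ _ => fderiv_fderiv_eq_deriv_deriv hf _

lemma deriv_deriv_nonneg_of_isLocalMin {g : ℝ → ℝ} (hg : ContinuousAt g 0)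
    (hmin : IsLocalMin g 0) : 0 ≤ deriv (deriv g) 0 := by
  by_contra! h
  have hmax := isLocalMax_of_deriv_deriv_neg h hmin.deriv_eq_zero hg
  have hc : g =ᶠ[𝓝 0] fun _ => g 0 := by
    filter_upwards [hmin, hmax] with s h1 h2 using le_antisymm h2 h1
  have : deriv (deriv g) 0 = 0 := by
    rw [hc.deriv.deriv_eq]; simp
  linarith

lemma laplacian_nonneg_of_isLocalMin {f : EuclideanSpace ℝ (Fin n) → ℝ}
    {x : EuclideanSpace ℝ (Fin n)} (hf : ContDiffAt ℝ 2 f x) (hmin : IsLocalMin f x) :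
    0 ≤ laplacian f x := by
  rw [laplacian_eq_sum_deriv_deriv hf]
  refine Finset.sum_nonneg fun i _ => ?_
  have hc : Continuous fun s : ℝ => x + s • (EuclideanSpace.single i (1 : ℝ)) := by fun_prop
  have hline : Tendsto (fun s : ℝ => x + s • (EuclideanSpace.single i (1 : ℝ))) (𝓝 0) (𝓝 x) := by
    simpa using hc.tendsto 0
  apply deriv_deriv_nonneg_of_isLocalMin
  · apply ContinuousAt.comp (g := f) _ hc.continuousAt
    simpa using hf.continuousAt
  · filter_upwards [hline.eventually hmin] with s hs
    simpa using hs

lemma laplacian_congr {f g : EuclideanSpace ℝ (Fin n) → ℝ} {x : EuclideanSpace ℝ (Fin n)}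
    (h : f =ᶠ[𝓝 x] g) : laplacian f x = laplacian g x := by
  refine Finset.sum_congr rfl fun i _ => ?_
  have : (fun y => fderiv ℝ f y (EuclideanSpace.single i 1)) =ᶠ[𝓝 x]
      fun y => fderiv ℝ g y (EuclideanSpace.single i 1) := by
    filter_upwards [h.fderiv (𝕜 := ℝ)] with y hy
    rw [hy]
  rw [this.fderiv_eq]

lemma laplacian_add {f g : EuclideanSpace ℝ (Fin n) → ℝ} {x : EuclideanSpace ℝ (Fin n)}
    (hf : ContDiffAt ℝ 2 f x) (hg : ContDiffAt ℝ 2 g x) :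
    laplacian (fun y => f y + g y) x = laplacian f x + laplacian g x := by
  unfold laplacian
  rw [← Finset.sum_add_distrib]
  refine Finset.sum_congr rfl fun i _ => ?_
  have : (fun y => fderiv ℝ (fun y => f y + g y) y (EuclideanSpace.single i 1)) =ᶠ[𝓝 x]
      fun y => fderiv ℝ f y (EuclideanSpace.single i 1)
        + fderiv ℝ g y (EuclideanSpace.single i 1) := by
    filter_upwards [hf.eventually (by simp), hg.eventually (by simp)] with y h1 h2
    rw [fderiv_fun_add (h1.differentiableAt (by norm_num)) (h2.differentiableAt (by norm_num))]
    rfl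
  have hd : ∀ {h : EuclideanSpace ℝ (Fin n) → ℝ}, ContDiffAt ℝ 2 h x →
      DifferentiableAt ℝ (fun y => fderiv ℝ h y (EuclideanSpace.single i (1 : ℝ))) x := fun hh =>
    ((hh.fderiv_right (m := 1) (by norm_num)).differentiableAt (by norm_num)).clm_apply
      (differentiableAt_const _)
  rw [this.fderiv_eq, fderiv_fun_add (hd hf) (hd hg)]
  rfl

lemma laplacian_const_mul (c : ℝ) {f : EuclideanSpace ℝ (Fin n) → ℝ}
    {x : EuclideanSpace ℝ (Fin n)} (hf : ContDiffAt ℝ 2 f x) :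
    laplacian (fun y => c * f y) x = c * laplacian f x := by
  unfold laplacian
  rw [Finset.mul_sum]
  refine Finset.sum_congr rfl fun i _ => ?_
  have : (fun y => fderiv ℝ (fun y => c * f y) y (EuclideanSpace.single i 1)) =ᶠ[𝓝 x]
      fun y => c * fderiv ℝ f y (EuclideanSpace.single i 1) := by
    filter_upwards [hf.eventually (by simp)] with y h1
    rw [fderiv_const_mul (h1.differentiableAt (by norm_num))]
    rfl
  have hd : DifferentiableAt ℝ (fun y => fderiv ℝ f y (EuclideanSpace.single i (1 : ℝ))) x :=
    ((hf.fderiv_right (m := 1) (by norm_num)).differentiableAt (by norm_num)).clm_apply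
      (differentiableAt_const _)
  rw [this.fderiv_eq, fderiv_const_mul hd]
  rfl

end Laplacian

/-! ### Solutions of the heat equation and the maximum principle -/

section Caloric

variable {n : ℕ}

/-- `w` is jointly continuous and solves the heat equation on `V` at all times. -/
structure IsCaloricOn (V : Set (EuclideanSpace ℝ (Fin n)))
    (w : ℝ → EuclideanSpace ℝ (Fin n) → ℝ) : Prop where
  continuous : Continuous fun p : ℝ × EuclideanSpace ℝ (Fin n) => w p.1 p.2
  contDiffAt : ∀ t, ∀ x ∈ V, ContDiffAt ℝ 2 (w t) x
  heatEq : ∀ t, ∀ x ∈ V, HasDerivAt (fun s => w s x) (laplacian (w t) x) t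

variable {V : Set (EuclideanSpace ℝ (Fin n))} {v w : ℝ → EuclideanSpace ℝ (Fin n) → ℝ}

lemma IsCaloricOn.add (hv : IsCaloricOn V v) (hw : IsCaloricOn V w) :
    IsCaloricOn V fun t x => v t x + w t x where
  continuous := hv.continuous.add hw.continuous
  contDiffAt t x hx := (hv.contDiffAt t x hx).add (hw.contDiffAt t x hx)
  heatEq t x hx := by
    rw [laplacian_add (hv.contDiffAt t x hx) (hw.contDiffAt t x hx)]
    exact (hv.heatEq t x hx).add (hw.heatEq t x hx)

lemma IsCaloricOn.const_mul (c : ℝ) (hv : IsCaloricOn V v) :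
    IsCaloricOn V fun t x => c * v t x where
  continuous := continuous_const.mul hv.continuous
  contDiffAt t x hx := contDiffAt_const.mul (hv.contDiffAt t x hx)
  heatEq t x hx := by
    rw [laplacian_const_mul c (hv.contDiffAt t x hx)]
    exact (hv.heatEq t x hx).const_mul c

lemma IsCaloricOn.const (V : Set (EuclideanSpace ℝ (Fin n))) (c : ℝ) :
    IsCaloricOn V fun _ _ => c where
  continuous := continuous_const
  contDiffAt _ _ _ := contDiffAt_const
  heatEq t x _ := by
    have : laplacian (fun _ : EuclideanSpace ℝ (Fin n) => c) x = 0 := by simp [laplacian]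
    rw [this]
    exact hasDerivAt_const t c

lemma IsCaloricOn.sum {ι : Type*} (s : Finset ι) {w : ι → ℝ → EuclideanSpace ℝ (Fin n) → ℝ}
    (hw : ∀ j, IsCaloricOn V (w j)) : IsCaloricOn V fun t x => ∑ j ∈ s, w j t x := by
  classical
  induction s using Finset.induction_on with
  | empty => simpa using IsCaloricOn.const V 0
  | insert j s hj ih =>
    simp only [Finset.sum_insert hj]
    exact (hw j).add ih

lemma isCaloricOn_exp_mul {g : EuclideanSpace ℝ (Fin n) → ℝ} {μ : ℝ} (hc : Continuous g)
    (hg : ∀ x ∈ V, ContDiffAt ℝ 2 g x) (heq : ∀ x ∈ V, laplacian g x = -μ * g x) :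
    IsCaloricOn V fun t x => exp (-μ * t) * g x where
  continuous := by fun_prop
  contDiffAt t x hx := contDiffAt_const.mul (hg x hx)
  heatEq t x hx := by
    rw [laplacian_const_mul _ (hg x hx), heq x hx]
    have h1 : HasDerivAt (fun s : ℝ => -μ * s) (-μ) t := by
      simpa using (hasDerivAt_id t).const_mul (-μ)
    exact (h1.exp.mul_const (g x)).congr_deriv (by ring)

/-- Minimum principle for the heat equation on a bounded open set. -/
lemma IsCaloricOn.nonneg (hw : IsCaloricOn V w) (hV : IsOpen V) (hb : Bornology.IsBounded V)
    (h0 : ∀ x ∈ closure V, 0 ≤ w 0 x) (hfr : ∀ t, 0 ≤ t → ∀ x ∈ frontier V, 0 ≤ w t x)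
    {T : ℝ} (hT : 0 ≤ T) {x : EuclideanSpace ℝ (Fin n)} (hx : x ∈ closure V) : 0 ≤ w T x := by
  have key : ∀ η > 0, 0 ≤ w T x + η * T := by
    intro η hη
    have hcont : Continuous fun p : ℝ × EuclideanSpace ℝ (Fin n) => w p.1 p.2 + η * p.1 :=
      hw.continuous.add (by fun_prop)
    obtain ⟨⟨t₀, x₀⟩, ⟨ht₀, hx₀⟩, hmin⟩ :=
      (isCompact_Icc.prod hb.isCompact_closure).exists_isMinOn
        (⟨(T, x), ⟨right_mem_Icc.2 hT, hx⟩⟩ : (Icc 0 T ×ˢ closure V).Nonempty) hcont.continuousOn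
    refine le_trans ?_ (hmin (show (T, x) ∈ Icc 0 T ×ˢ closure V from ⟨right_mem_Icc.2 hT, hx⟩))
    show 0 ≤ w t₀ x₀ + η * t₀
    by_contra! hneg
    simp only at ht₀ hx₀
    have hV₀ : x₀ ∈ V := by
      by_contra hV₀
      have : x₀ ∈ frontier V := by rw [hV.frontier_eq]; exact ⟨hx₀, hV₀⟩
      nlinarith [hfr t₀ ht₀.1 x₀ this, ht₀.1]
    have ht₀' : 0 < t₀ := by
      rcases ht₀.1.eq_or_lt with h | h
      · subst h
        have := h0 x₀ hx₀
        simp at hneg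
        linarith
      · exact h
    have hlap : 0 ≤ laplacian (w t₀) x₀ := by
      refine laplacian_nonneg_of_isLocalMin (hw.contDiffAt t₀ x₀ hV₀) ?_
      filter_upwards [hV.mem_nhds hV₀] with y hy
      have : w t₀ x₀ + η * t₀ ≤ w t₀ y + η * t₀ :=
        hmin (show (t₀, y) ∈ Icc 0 T ×ˢ closure V from ⟨ht₀, subset_closure hy⟩)
      linarith
    have hd : HasDerivAt (fun s => w s x₀ + η * s) (laplacian (w t₀) x₀ + η) t₀ := by
      exact ((hw.heatEq t₀ x₀ hV₀).add ((hasDerivAt_id t₀).const_mul η)).congr_deriv (by simp)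
    have hpos : 0 < laplacian (w t₀) x₀ + η := by linarith
    have hslope := (hasDerivAt_iff_tendsto_slope_left_right.1 hd).1.eventually (lt_mem_nhds hpos)
    have hIoo : Ioo 0 t₀ ∈ 𝓝[<] t₀ := Ioo_mem_nhdsLT ht₀'
    obtain ⟨s, hs, hsI⟩ := (hslope.and hIoo).exists
    have h2 : w t₀ x₀ + η * t₀ ≤ w s x₀ + η * s :=
      hmin (show (s, x₀) ∈ Icc 0 T ×ˢ closure V from ⟨⟨hsI.1.le, hsI.2.le.trans ht₀.2⟩, hx₀⟩)
    rw [slope_def_field] at hs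
    have : (w s x₀ + η * s - (w t₀ x₀ + η * t₀)) / (s - t₀) ≤ 0 :=
      div_nonpos_of_nonneg_of_nonpos (by linarith) (by linarith [hsI.2])
    linarith
  by_contra! hneg
  have h1 := key (-(w T x) / (2 * (T + 1))) (by apply div_pos <;> linarith)
  have h2 : -(w T x) / (2 * (T + 1)) * T ≤ -(w T x) / 2 := by
    rw [div_mul_eq_mul_div, div_le_div_iff₀ (by linarith) (by norm_num)]
    nlinarith
  linarith

/-- Comparison of eigenvalues through a positive eigenfunction with zero boundary values and an
eigenfunction that is positive up to the boundary. -/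
lemma eigenvalue_le_of_pos {p q : EuclideanSpace ℝ (Fin n) → ℝ} {α β : ℝ} (hV : IsOpen V)
    (hb : Bornology.IsBounded V) (hne : V.Nonempty)
    (hp : Continuous p) (hq : ContinuousOn q (closure V))
    (hpd : ∀ x ∈ V, ContDiffAt ℝ 2 p x) (hqd : ∀ x ∈ V, ContDiffAt ℝ 2 q x)
    (hpe : ∀ x ∈ V, laplacian p x = -α * p x) (hqe : ∀ x ∈ V, laplacian q x = -β * q x)
    (hpp : ∀ x ∈ V, 0 < p x) (hp0 : ∀ x ∈ frontier V, p x = 0)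
    (hqp : ∀ x ∈ closure V, 0 < q x) : β ≤ α := by
  obtain ⟨x₀, hx₀, hmax⟩ := hb.isCompact_closure.exists_isMaxOn (hne.mono subset_closure)
    (hp.continuousOn.div hq fun x hx => (hqp x hx).ne')
  obtain ⟨y, hy⟩ := hne
  have hM : 0 < p x₀ / q x₀ :=
    (div_pos (hpp y hy) (hqp y (subset_closure hy))).trans_le (hmax (subset_closure hy))
  have hV₀ : x₀ ∈ V := by
    by_contra hV₀
    have : x₀ ∈ frontier V := by rw [hV.frontier_eq]; exact ⟨hx₀, hV₀⟩
    rw [hp0 x₀ this] at hM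
    simp at hM
  set M := p x₀ / q x₀
  have hMq : M * q x₀ = p x₀ := div_mul_cancel₀ _ (hqp x₀ hx₀).ne'
  have hd1 : ContDiffAt ℝ 2 (fun y => M * q y) x₀ := contDiffAt_const.mul (hqd x₀ hV₀)
  have hd2 : ContDiffAt ℝ 2 (fun y => (-1) * p y) x₀ := contDiffAt_const.mul (hpd x₀ hV₀)
  have hlap : 0 ≤ laplacian (fun y => M * q y + (-1) * p y) x₀ := by
    refine laplacian_nonneg_of_isLocalMin (hd1.add hd2) ?_
    filter_upwards [hV.mem_nhds hV₀] with y hy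
    have h1 : p y / q y ≤ M := hmax (subset_closure hy)
    rw [div_le_iff₀ (hqp y (subset_closure hy))] at h1
    linarith
  rw [laplacian_add hd1 hd2, laplacian_const_mul _ (hqd x₀ hV₀), laplacian_const_mul _ (hpd x₀ hV₀),
    hpe x₀ hV₀, hqe x₀ hV₀] at hlap
  have h3 : 0 ≤ (α - β) * p x₀ := by rw [← hMq] at hlap ⊢; linarith
  have := nonneg_of_mul_nonneg_left h3 (hpp x₀ hV₀)
  linarith

end Caloric

/-! ### Sine modes of a box -/

section SineMode

variable {n : ℕ}

/-- The Dirichlet eigenfunction of `box n a` with frequencies `k`, up to normalization. -/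
noncomputable def sineMode (a : Fin n → ℝ) (k : Fin n → ℕ) (x : EuclideanSpace ℝ (Fin n)) : ℝ :=
  ∏ i, sin (k i * (π / 2 * (x i / a i + 1)))

/-- The Dirichlet eigenvalue of `box n a` with frequencies `k`. -/
noncomputable def sineEigenvalue (a : Fin n → ℝ) (k : Fin n → ℕ) : ℝ :=
  ∑ i, (k i * (π / (2 * a i))) ^ 2

lemma contDiff_sineMode (a : Fin n → ℝ) (k : Fin n → ℕ) {m : WithTop ℕ∞} :
    ContDiff ℝ m (sineMode a k) := by
  unfold sineMode
  refine contDiff_prod fun i _ => ?_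
  have : ContDiff ℝ m fun x : EuclideanSpace ℝ (Fin n) => x i := by fun_prop
  exact Real.contDiff_sin.comp
    (contDiff_const.mul (contDiff_const.mul ((this.div_const _).add contDiff_const)))

lemma continuous_sineMode (a : Fin n → ℝ) (k : Fin n → ℕ) : Continuous (sineMode a k) :=
  (contDiff_sineMode a k (m := 0)).continuous

lemma deriv_deriv_sin_mul (θ β R : ℝ) :
    deriv (deriv fun s : ℝ => sin (θ + s * β) * R) 0 = -β ^ 2 * (sin θ * R) := by
  have h1 : (deriv fun s : ℝ => sin (θ + s * β) * R) = fun s => cos (θ + s * β) * β * R := by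
    funext s
    have h : HasDerivAt (fun s : ℝ => θ + s * β) β s := by
      simpa using ((hasDerivAt_id s).mul_const β).const_add θ
    exact (h.sin.mul_const R).deriv
  rw [h1]
  have h : HasDerivAt (fun s : ℝ => θ + s * β) β 0 := by
    simpa using ((hasDerivAt_id (0 : ℝ)).mul_const β).const_add θ
  rw [((h.cos.mul_const β).mul_const R).deriv]
  simp only [zero_mul, add_zero]
  ring

lemma laplacian_sineMode (a : Fin n → ℝ) (k : Fin n → ℕ) (x : EuclideanSpace ℝ (Fin n)) :
    laplacian (sineMode a k) x = -sineEigenvalue a k * sineMode a k x := by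
  rw [laplacian_eq_sum_deriv_deriv (contDiff_sineMode a k).contDiffAt, sineEigenvalue,
    ← Finset.sum_neg_distrib, Finset.sum_mul]
  refine Finset.sum_congr rfl fun i _ => ?_
  have h : (fun s : ℝ => sineMode a k (x + s • EuclideanSpace.single i 1)) =
      fun s => sin (k i * (π / 2 * (x i / a i + 1)) + s * (k i * (π / (2 * a i)))) *
        ∏ j ∈ Finset.univ.erase i, sin (k j * (π / 2 * (x j / a j + 1))) := by
    funext s
    rw [sineMode, ← Finset.mul_prod_erase _ _ (Finset.mem_univ i)]
    congr 1
    · congr 1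
      simp
      ring
    · refine Finset.prod_congr rfl fun j hj => ?_
      simp [Finset.ne_of_mem_erase hj]
  rw [h, deriv_deriv_sin_mul, sineMode, ← Finset.mul_prod_erase _ _ (Finset.mem_univ i)]

lemma isCaloricOn_sineMode (V : Set (EuclideanSpace ℝ (Fin n))) (a : Fin n → ℝ)
    (k : Fin n → ℕ) :
    IsCaloricOn V fun t x => exp (-sineEigenvalue a k * t) * sineMode a k x :=
  isCaloricOn_exp_mul (continuous_sineMode a k) (fun _ _ => (contDiff_sineMode a k).contDiffAt)
    fun x _ => laplacian_sineMode a k x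

lemma sineMode_one_eq (a : Fin n → ℝ) (x : EuclideanSpace ℝ (Fin n)) :
    sineMode a 1 x = ∏ i, cos (π * x i / (2 * a i)) := by
  refine Finset.prod_congr rfl fun i _ => ?_
  rw [← Real.sin_add_pi_div_two]
  congr 1
  simp
  ring

lemma boxEigenfunction_eq {a : Fin n → ℝ} (ha : ∀ i, 0 < a i) (x : EuclideanSpace ℝ (Fin n)) :
    boxEigenfunction n a x = sineMode a 1 x / sqrt (∏ i, a i) := by
  rw [boxEigenfunction, Finset.prod_mul_distrib, sineMode_one_eq,
    Real.sqrt_prod _ fun i _ => (ha i).le]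
  simp [div_eq_inv_mul]

lemma cos_bounds {a t : ℝ} (ha : 0 < a) (ht : |t| ≤ a) :
    1 - |t| / a ≤ cos (π * t / (2 * a)) ∧ cos (π * t / (2 * a)) ≤ π / 2 * (1 - |t| / a) := by
  have h1 : |t| / a ≤ 1 := (div_le_one ha).2 ht
  have h0 : 0 ≤ |t| / a := by positivity
  have h2 : cos (π * t / (2 * a)) = sin (π / 2 * (1 - |t| / a)) := by
    rw [← Real.cos_abs, ← Real.cos_pi_div_two_sub]
    congr 1
    rw [abs_div, abs_mul, abs_of_pos pi_pos, abs_of_pos (by positivity : 0 < 2 * a)]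
    field_simp
    ring
  rw [h2]
  constructor
  · have := Real.mul_le_sin (x := π / 2 * (1 - |t| / a))
      (mul_nonneg (by positivity) (by linarith)) (by nlinarith [pi_pos])
    refine le_trans (le_of_eq ?_) this
    field_simp
  · exact Real.sin_le (mul_nonneg (by positivity) (by linarith))

lemma sineMode_one_nonneg {a : Fin n → ℝ} (ha : ∀ i, 0 < a i) {x : EuclideanSpace ℝ (Fin n)}
    (hx : ∀ i, |x i| ≤ a i) : 0 ≤ sineMode a 1 x := by
  rw [sineMode_one_eq]
  exact Finset.prod_nonneg fun i _ =>
    le_trans (sub_nonneg.2 ((div_le_one (ha i)).2 (hx i))) (cos_bounds (ha i) (hx i)).1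

lemma sineMode_one_pos {a : Fin n → ℝ} (ha : ∀ i, 0 < a i) {x : EuclideanSpace ℝ (Fin n)}
    (hx : ∀ i, |x i| < a i) : 0 < sineMode a 1 x := by
  rw [sineMode_one_eq]
  exact Finset.prod_pos fun i _ =>
    lt_of_lt_of_le (sub_pos.2 ((div_lt_one (ha i)).2 (hx i))) (cos_bounds (ha i) (hx i).le).1

lemma abs_sineMode_le_one (a : Fin n → ℝ) (k : Fin n → ℕ) (x : EuclideanSpace ℝ (Fin n)) :
    |sineMode a k x| ≤ 1 := by
  rw [sineMode, Finset.abs_prod]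
  exact Finset.prod_le_one (fun _ _ => abs_nonneg _) fun _ _ => abs_sin_le_one _

lemma sineMode_eq_zero {a : Fin n → ℝ} (k : Fin n → ℕ) {x : EuclideanSpace ℝ (Fin n)}
    {i : Fin n} (ha : 0 < a i) (hx : |x i| = a i) : sineMode a k x = 0 := by
  refine Finset.prod_eq_zero (Finset.mem_univ i) ?_
  rcases eq_or_eq_neg_of_abs_eq hx with h | h
  · have : (k i : ℝ) * (π / 2 * (x i / a i + 1)) = k i * π := by
      rw [h, div_self ha.ne']; ring
    rw [this, sin_nat_mul_pi]
  · rw [h, neg_div, div_self ha.ne']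
    simp

lemma abs_sin_nat_mul_le (k : ℕ) (θ : ℝ) : |sin (k * θ)| ≤ k * |sin θ| := by
  induction k with
  | zero => simp
  | succ k ih =>
    push_cast
    rw [add_mul, one_mul, sin_add]
    calc |sin (k * θ) * cos θ + cos (k * θ) * sin θ|
        ≤ |sin (k * θ)| * |cos θ| + |cos (k * θ)| * |sin θ| := by
          rw [← abs_mul, ← abs_mul]; exact abs_add_le _ _
      _ ≤ |sin (k * θ)| * 1 + 1 * |sin θ| := by
          gcongr <;> exact abs_cos_le_one _
      _ ≤ (k + 1) * |sin θ| := by linarith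

lemma abs_sineMode_le {a : Fin n → ℝ} (ha : ∀ i, 0 < a i) (k : Fin n → ℕ)
    {x : EuclideanSpace ℝ (Fin n)} (hx : ∀ i, |x i| ≤ a i) :
    |sineMode a k x| ≤ (∏ i, (k i : ℝ)) * sineMode a 1 x := by
  rw [← abs_of_nonneg (sineMode_one_nonneg ha hx), sineMode, sineMode, Finset.abs_prod,
    Finset.abs_prod, ← Finset.prod_mul_distrib]
  refine Finset.prod_le_prod (fun _ _ => abs_nonneg _) fun i _ => ?_
  simpa using abs_sin_nat_mul_le (k i) (π / 2 * (x i / a i + 1))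

/-! ### Boxes -/

lemma isOpen_box (a : Fin n → ℝ) : IsOpen (box n a) := by
  have : box n a = ⋂ i, {x : EuclideanSpace ℝ (Fin n) | |x i| < a i} := by
    ext; simp [box]
  rw [this]
  exact isOpen_iInter_of_finite fun i => isOpen_lt (by fun_prop) continuous_const

/-- The closed box `∏ i [-a i, a i]` in `ℝⁿ`. -/
def closedBox (n : ℕ) (a : Fin n → ℝ) : Set (EuclideanSpace ℝ (Fin n)) := {x | ∀ i, |x i| ≤ a i}

lemma box_subset_closedBox (a : Fin n → ℝ) : box n a ⊆ closedBox n a := fun _ hx i => (hx i).le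

lemma isClosed_closedBox (a : Fin n → ℝ) : IsClosed (closedBox n a) := by
  have : closedBox n a = ⋂ i, {x : EuclideanSpace ℝ (Fin n) | |x i| ≤ a i} := by
    ext; simp [closedBox]
  rw [this]
  exact isClosed_iInter fun i => isClosed_le (by fun_prop) continuous_const

lemma isCompact_closedBox (a : Fin n → ℝ) : IsCompact (closedBox n a) := by
  refine Metric.isCompact_of_isClosed_isBounded (isClosed_closedBox a) ?_
  refine (Metric.isBounded_closedBall (x := 0) (r := ∑ i, a i)).subset fun x hx => ?_
  rw [mem_closedBall_zero_iff]
  calc ‖x‖ = ‖∑ i, x i • EuclideanSpace.single i (1 : ℝ)‖ := by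
        congr 1
        ext j
        simp [Finset.sum_apply, Pi.single_apply]
    _ ≤ ∑ i, ‖x i • EuclideanSpace.single i (1 : ℝ)‖ := norm_sum_le _ _
    _ ≤ ∑ i, a i := Finset.sum_le_sum fun i _ => by simpa [norm_smul] using hx i

lemma isBounded_box (a : Fin n → ℝ) : Bornology.IsBounded (box n a) :=
  (isCompact_closedBox a).isBounded.subset (box_subset_closedBox a)

lemma closure_box_subset (a : Fin n → ℝ) : closure (box n a) ⊆ closedBox n a :=
  closure_minimal (box_subset_closedBox a) (isClosed_closedBox a)

lemma exists_abs_eq_of_mem_frontier_box {a : Fin n → ℝ} {x : EuclideanSpace ℝ (Fin n)}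
    (hx : x ∈ frontier (box n a)) : ∃ i, |x i| = a i := by
  rw [(isOpen_box a).frontier_eq] at hx
  have h1 := closure_box_subset a hx.1
  by_contra! h
  exact hx.2 fun i => (h1 i).lt_of_ne (h i)

lemma sineMode_eq_zero_of_mem_frontier {a : Fin n → ℝ} (ha : ∀ i, 0 < a i) (k : Fin n → ℕ)
    {x : EuclideanSpace ℝ (Fin n)} (hx : x ∈ frontier (box n a)) : sineMode a k x = 0 :=
  let ⟨i, hi⟩ := exists_abs_eq_of_mem_frontier_box hx
  sineMode_eq_zero k (ha i) hi

lemma le_of_box_subset_box {a b : Fin n → ℝ} (ha : ∀ i, 0 < a i) (hb : ∀ i, 0 < b i)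
    (h : box n a ⊆ box n b) (i : Fin n) : a i ≤ b i := by
  by_contra! hlt
  have : EuclideanSpace.single i (b i) ∈ box n a := fun j => by
    rcases eq_or_ne j i with rfl | hj
    · simpa [abs_of_pos (hb j)] using hlt
    · simpa [hj] using ha j
  have := h this i
  simp [abs_of_pos (hb i)] at this

end SineMode

/-! ### Uniform approximation by sine modes -/

section Approximation

variable {n : ℕ}

lemma sineMode_update (a : Fin n → ℝ) (k : Fin n → ℕ) (i : Fin n) (m : ℕ)
    (x : EuclideanSpace ℝ (Fin n)) :
    sineMode a (Function.update k i m) x = sin (m * (π / 2 * (x i / a i + 1))) *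
      ∏ j ∈ Finset.univ.erase i, sin (k j * (π / 2 * (x j / a j + 1))) := by
  rw [sineMode, ← Finset.mul_prod_erase _ _ (Finset.mem_univ i)]
  congr 1
  · simp
  · refine Finset.prod_congr rfl fun j hj => ?_
    simp [Finset.ne_of_mem_erase hj]

lemma cos_mul_sineMode (a : Fin n → ℝ) {k : Fin n → ℕ} {i : Fin n} (hk : k i ≠ 0)
    (x : EuclideanSpace ℝ (Fin n)) :
    cos (π / 2 * (x i / a i + 1)) * sineMode a k x =
      (1 / 2) * sineMode a (Function.update k i (k i + 1)) x +
      (1 / 2) * sineMode a (Function.update k i (k i - 1)) x := by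
  have h : sineMode a k x = sineMode a (Function.update k i (k i)) x := by simp
  rw [h, sineMode_update, sineMode_update, sineMode_update, Nat.cast_sub (Nat.one_le_iff_ne_zero.2 hk)]
  push_cast
  rw [add_mul, sub_mul, one_mul, sin_add, sin_sub]
  ring

/-- Sine modes as continuous functions on the closed box. -/
noncomputable def sineModeMap (a : Fin n → ℝ) (k : Fin n → ℕ) : C(closedBox n a, ℝ) :=
  ⟨fun x => sineMode a k x, (continuous_sineMode a k).comp continuous_subtype_val⟩

/-- The functions `cos (π / 2 * (x i / a i + 1))` on the closed box. -/
noncomputable def cosMap (a : Fin n → ℝ) (i : Fin n) : C(closedBox n a, ℝ) :=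
  ⟨fun x => cos (π / 2 * (x.1 i / a i + 1)), by fun_prop⟩

lemma mul_mem_span_sineModeMap {a : Fin n → ℝ} {p : C(closedBox n a, ℝ)}
    (hp : p ∈ Algebra.adjoin ℝ (range (cosMap a))) :
    ∀ w ∈ Submodule.span ℝ (range (sineModeMap a)),
      p * w ∈ Submodule.span ℝ (range (sineModeMap a)) := by
  induction hp using Algebra.adjoin_induction with
  | mem p hp =>
    obtain ⟨i, rfl⟩ := hp
    intro w hw
    induction hw using Submodule.span_induction with
    | mem w hw =>
      obtain ⟨k, rfl⟩ := hw
      by_cases hk : k i = 0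
      · have : cosMap a i * sineModeMap a k = 0 := by
          ext x
          have : sineMode a k x = 0 :=
            Finset.prod_eq_zero (Finset.mem_univ i) (by simp [hk])
          simp [sineModeMap, this]
        rw [this]
        exact Submodule.zero_mem _
      · have : cosMap a i * sineModeMap a k =
            (1 / 2 : ℝ) • sineModeMap a (Function.update k i (k i + 1)) +
            (1 / 2 : ℝ) • sineModeMap a (Function.update k i (k i - 1)) := by
          ext x
          exact cos_mul_sineMode a hk x.1
        rw [this]
        exact Submodule.add_mem _ (Submodule.smul_mem _ _ (Submodule.subset_span ⟨_, rfl⟩))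
          (Submodule.smul_mem _ _ (Submodule.subset_span ⟨_, rfl⟩))
    | zero => simp
    | add v w _ _ hv hw => rw [mul_add]; exact Submodule.add_mem _ hv hw
    | smul r w _ hw => rw [mul_smul_comm]; exact Submodule.smul_mem _ r hw
  | algebraMap r =>
    intro w hw
    rw [← Algebra.smul_def]
    exact Submodule.smul_mem _ r hw
  | add p q _ _ hp hq =>
    intro w hw
    rw [add_mul]
    exact Submodule.add_mem _ (hp w hw) (hq w hw)
  | mul p q _ _ hp hq =>
    intro w hw
    rw [mul_assoc]
    exact hp _ (hq w hw)

lemma separatesPoints_adjoin_cosMap {a : Fin n → ℝ} (ha : ∀ i, 0 < a i) :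
    (Algebra.adjoin ℝ (range (cosMap a))).SeparatesPoints := by
  intro x y hxy
  have : ∃ i, x.1 i ≠ y.1 i := by
    by_contra! h
    exact hxy (Subtype.ext (PiLp.ext h))
  obtain ⟨i, hi⟩ := this
  refine ⟨_, ⟨cosMap a i, Algebra.subset_adjoin ⟨i, rfl⟩, rfl⟩, fun h => hi ?_⟩
  have hmem : ∀ z : closedBox n a, π / 2 * (z.1 i / a i + 1) ∈ Icc 0 π := fun z => by
    have h1 : -1 ≤ z.1 i / a i := by
      rw [le_div_iff₀ (ha i)]; linarith [(abs_le.1 (z.2 i)).1]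
    have h2 : z.1 i / a i ≤ 1 := by
      rw [div_le_one (ha i)]; exact (abs_le.1 (z.2 i)).2
    constructor <;> nlinarith [pi_pos]
  have := injOn_cos (hmem x) (hmem y) h
  have h3 := mul_left_cancel₀ (by positivity : π / 2 ≠ 0) this
  have h4 : x.1 i / a i = y.1 i / a i := by linarith
  exact (div_left_inj' (ha i).ne').1 h4

lemma exists_sineMode_approx {a : Fin n → ℝ} (ha : ∀ i, 0 < a i)
    {h : EuclideanSpace ℝ (Fin n) → ℝ} (hh : ContinuousOn h (closedBox n a)) {ε : ℝ} (hε : 0 < ε) :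
    ∃ (s : Finset (Fin n → ℕ)) (c : (Fin n → ℕ) → ℝ), ∀ x ∈ closedBox n a,
      |∑ k ∈ s, c k * sineMode a k x - sineMode a 1 x * h x| ≤ ε := by
  have : CompactSpace (closedBox n a) := isCompact_iff_compactSpace.1 (isCompact_closedBox a)
  obtain ⟨⟨p, hp⟩, hpε⟩ :=
    ContinuousMap.exists_mem_subalgebra_near_continuous_of_separatesPoints _
      (separatesPoints_adjoin_cosMap ha) ((closedBox n a).domRestrict h) hh.domRestrict ε hε
  have hmem := mul_mem_span_sineModeMap hp (sineModeMap a 1) (Submodule.subset_span ⟨1, rfl⟩)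
  obtain ⟨c, hc⟩ := Finsupp.mem_span_range_iff_exists_finsupp.1 hmem
  refine ⟨c.support, c, fun x hx => ?_⟩
  have h1 : ∑ k ∈ c.support, c k * sineMode a k x = p ⟨x, hx⟩ * sineMode a 1 x := by
    have := congrArg (fun f : C(closedBox n a, ℝ) => f ⟨x, hx⟩) hc
    simpa [Finsupp.sum, ContinuousMap.sum_apply, sineModeMap] using this
  have h2 : |p ⟨x, hx⟩ - h x| < ε := hpε ⟨x, hx⟩
  rw [h1, mul_comm, ← mul_sub, abs_mul]
  calc |sineMode a 1 x| * |p ⟨x, hx⟩ - h x| ≤ 1 * ε := by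
        gcongr
        exact abs_sineMode_le_one _ _ _
    _ = ε := one_mul ε

end Approximation

/-! ### Orthogonality -/

section Orthogonality

variable {n : ℕ}

lemma setIntegral_box_prod (a : Fin n → ℝ) (f : Fin n → ℝ → ℝ) :
    ∫ x in box n a, ∏ i, f i (x i) = ∏ i, ∫ t in Ioo (-a i) (a i), f i t := by
  have hbox : box n a = (MeasurableEquiv.toLp 2 (Fin n → ℝ)).symm ⁻¹'
      (Set.pi univ fun i => Ioo (-a i) (a i)) := by
    ext x
    simp [box, abs_lt]
  rw [hbox]
  have := (EuclideanSpace.volume_preserving_symm_measurableEquiv_toLp (Fin n)).setIntegral_preimage_emb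
    (MeasurableEquiv.measurableEmbedding _) (fun y : Fin n → ℝ => ∏ i, f i (y i))
    (Set.pi univ fun i => Ioo (-a i) (a i))
  refine Eq.trans this ?_
  rw [volume_pi, Measure.restrict_pi_pi, integral_fintype_prod_eq_prod]

lemma volume_real_box {a : Fin n → ℝ} (ha : ∀ i, 0 < a i) :
    volume.real (box n a) = 2 ^ n * ∏ i, a i := by
  have h := setIntegral_box_prod a fun _ _ => 1
  simp only [Finset.prod_const_one, setIntegral_const, smul_eq_mul, mul_one,
    Real.volume_real_Ioo, sub_neg_eq_add] at h
  rw [h]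
  have : ∀ i, max (a i + a i) 0 = 2 * a i := fun i => by
    rw [max_eq_left (by linarith [ha i])]; ring
  simp [this, Finset.prod_mul_distrib]

lemma integral_cos_int_mul {m : ℤ} (hm : m ≠ 0) : ∫ θ in (0 : ℝ)..π, cos (m * θ) = 0 := by
  have hm' : (m : ℝ) ≠ 0 := by exact_mod_cast hm
  rw [intervalIntegral.integral_comp_mul_left (fun θ => cos θ) hm', integral_cos]
  simp [sin_int_mul_pi]

lemma integral_sin_mul_sin {k l : ℕ} (hk : k ≠ 0) :
    ∫ θ in (0 : ℝ)..π, sin (k * θ) * sin (l * θ) = if k = l then π / 2 else 0 := by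
  have h : (fun θ : ℝ => sin (k * θ) * sin (l * θ)) =
      fun θ => (1 / 2) * cos (((k - l : ℤ) : ℝ) * θ) - (1 / 2) * cos (((k + l : ℤ) : ℝ) * θ) := by
    funext θ
    push_cast
    rw [sub_mul, add_mul, cos_sub, cos_add]
    ring
  rw [h, intervalIntegral.integral_sub (by apply Continuous.intervalIntegrable; fun_prop)
    (by apply Continuous.intervalIntegrable; fun_prop), intervalIntegral.integral_const_mul,
    intervalIntegral.integral_const_mul, integral_cos_int_mul (by omega : (k + l : ℤ) ≠ 0)]
  split_ifs with hkl
  · subst hkl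
    simp
    ring
  · rw [integral_cos_int_mul (by omega)]
    simp

lemma setIntegral_sin_mul_sin {a : ℝ} (ha : 0 < a) {k l : ℕ} (hk : k ≠ 0) :
    ∫ t in Ioo (-a) a, sin (k * (π / 2 * (t / a + 1))) * sin (l * (π / 2 * (t / a + 1))) =
      if k = l then a else 0 := by
  rw [← integral_Ioc_eq_integral_Ioo, ← intervalIntegral.integral_of_le (by linarith)]
  have hc : π / (2 * a) ≠ 0 := by positivity
  have h := intervalIntegral.integral_comp_mul_add (a := -a) (b := a)
    (fun θ : ℝ => sin (k * θ) * sin (l * θ)) hc (π / 2)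
  have h1 : ∀ t : ℝ, π / (2 * a) * t + π / 2 = π / 2 * (t / a + 1) := fun t => by
    field_simp
  simp only [h1] at h
  rw [h]
  have h2 : π / 2 * (-a / a + 1) = 0 := by rw [neg_div, div_self ha.ne']; ring
  have h3 : π / 2 * (a / a + 1) = π := by rw [div_self ha.ne']; ring
  rw [h2, h3, integral_sin_mul_sin hk]
  split_ifs
  · simp
    field_simp
  · simp

lemma setIntegral_sineMode_mul_sineMode {a : Fin n → ℝ} (ha : ∀ i, 0 < a i) {k l : Fin n → ℕ}
    (hk : ∀ i, k i ≠ 0) :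
    ∫ x in box n a, sineMode a k x * sineMode a l x = if k = l then ∏ i, a i else 0 := by
  simp only [sineMode, ← Finset.prod_mul_distrib]
  rw [setIntegral_box_prod a fun i t =>
    sin (k i * (π / 2 * (t / a i + 1))) * sin (l i * (π / 2 * (t / a i + 1)))]
  simp only [setIntegral_sin_mul_sin (ha _) (hk _)]
  split_ifs with h
  · simp [h]
  · obtain ⟨i, hi⟩ := Function.ne_iff.1 h
    exact Finset.prod_eq_zero (Finset.mem_univ i) (if_neg hi)

lemma integrableOn_box {f : EuclideanSpace ℝ (Fin n) → ℝ} (a : Fin n → ℝ)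
    (hf : ContinuousOn f (closedBox n a)) : IntegrableOn f (box n a) :=
  (hf.integrableOn_compact (isCompact_closedBox a)).mono_set (box_subset_closedBox a)

lemma measurableSet_box (a : Fin n → ℝ) : MeasurableSet (box n a) := (isOpen_box a).measurableSet

lemma setIntegral_sum_mul_sineMode {a : Fin n → ℝ} (ha : ∀ i, 0 < a i) (s : Finset (Fin n → ℕ))
    (c : (Fin n → ℕ) → ℝ) {k : Fin n → ℕ} (hk : ∀ i, k i ≠ 0) :
    ∫ x in box n a, (∑ l ∈ s, c l * sineMode a l x) * sineMode a k x =
      (if k ∈ s then c k else 0) * ∏ i, a i := by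
  have h : ∀ x, (∑ l ∈ s, c l * sineMode a l x) * sineMode a k x =
      ∑ l ∈ s, c l * (sineMode a k x * sineMode a l x) := fun x => by
    rw [Finset.sum_mul]
    exact Finset.sum_congr rfl fun l _ => by ring
  simp only [h]
  have hint_on : ∀ l ∈ s, IntegrableOn (fun x => c l * (sineMode a k x * sineMode a l x)) (box n a) :=
    fun l _ => integrableOn_box a (continuous_const.mul
      ((continuous_sineMode a k).mul (continuous_sineMode a l))).continuousOn
  rw [integral_finsetSum s hint_on]
  simp only [integral_const_mul, setIntegral_sineMode_mul_sineMode ha hk, mul_ite, mul_zero,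
    Finset.sum_ite_eq, ite_mul, zero_mul]

end Orthogonality

/-! ### Coefficient and tail estimates -/

section Estimates

variable {n : ℕ}

lemma sum_range_mul_exp_le {A : ℝ} (hA : 0 < A) (N : ℕ) :
    ∑ m ∈ Finset.range N, (m : ℝ) * exp (-(A * ((m : ℝ) ^ 2 - 1))) ≤ 1 + 4 / A ^ 2 := by
  have key : ∀ N : ℕ, ∑ m ∈ Finset.range (N + 2), (m : ℝ) * exp (-(A * ((m : ℝ) ^ 2 - 1))) ≤
      1 + 4 / A ^ 2 * (1 - 1 / ((N : ℝ) + 1)) := by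
    intro N
    induction N with
    | zero => simp [Finset.sum_range_succ]
    | succ N ih =>
      rw [Finset.sum_range_succ]
      have hN : (0 : ℝ) ≤ N := N.cast_nonneg
      have hterm : ((N + 2 : ℕ) : ℝ) * exp (-(A * (((N + 2 : ℕ) : ℝ) ^ 2 - 1))) ≤
          4 / A ^ 2 * (1 / ((N : ℝ) + 1) - 1 / ((N : ℝ) + 2)) := by
        push_cast
        have hy : 0 ≤ A * (((N : ℝ) + 2) ^ 2 - 1) := mul_nonneg hA.le (by nlinarith)
        have he := Real.quadratic_le_exp_of_nonneg hy
        rw [exp_neg, ← div_eq_mul_inv, div_le_iff₀ (exp_pos _)]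
        have h1 : (1 / ((N : ℝ) + 1) - 1 / ((N : ℝ) + 2)) = 1 / (((N : ℝ) + 1) * (N + 2)) := by
          field_simp
          ring
        rw [h1, div_mul_div_comm, div_mul_eq_mul_div, le_div_iff₀ (by positivity)]
        have h2 : (A * (((N : ℝ) + 2) ^ 2 - 1)) ^ 2 / 2 ≤ exp (A * (((N : ℝ) + 2) ^ 2 - 1)) := by
          linarith
        have h3 : ((N : ℝ) + 2) * ((N + 1) * (N + 2)) ≤ 2 * (((N : ℝ) + 2) ^ 2 - 1) ^ 2 := by
          nlinarith [mul_nonneg hN hN, mul_nonneg (mul_nonneg hN hN) hN,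
            mul_nonneg (mul_nonneg hN hN) (mul_nonneg hN hN)]
        nlinarith [mul_le_mul_of_nonneg_left h3 (sq_nonneg A)]
      have h4 : (((N + 1 : ℕ) : ℝ) + 1) = N + 2 := by push_cast; ring
      rw [h4]
      calc _ ≤ 1 + 4 / A ^ 2 * (1 - 1 / ((N : ℝ) + 1)) +
            4 / A ^ 2 * (1 / ((N : ℝ) + 1) - 1 / ((N : ℝ) + 2)) := add_le_add ih hterm
        _ = _ := by ring
  calc _ ≤ ∑ m ∈ Finset.range (N + 2), (m : ℝ) * exp (-(A * ((m : ℝ) ^ 2 - 1))) :=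
        Finset.sum_le_sum_of_subset_of_nonneg (Finset.range_subset_range.2 (by omega))
          fun _ _ _ => by positivity
    _ ≤ 1 + 4 / A ^ 2 * (1 - 1 / ((N : ℝ) + 1)) := key N
    _ ≤ 1 + 4 / A ^ 2 * 1 := by
        gcongr
        have : (0 : ℝ) ≤ 1 / ((N : ℝ) + 1) := by positivity
        linarith
    _ = _ := by ring

lemma sum_erase_one_prod_mul_exp_le {A : ℝ} (hA : 0 < A) (s : Finset (Fin n → ℕ)) :
    ∑ k ∈ s.erase 1, ∏ i, ((k i : ℝ) * exp (-(A * ((k i : ℝ) ^ 2 - 1)))) ≤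
      (1 + 4 / A ^ 2) ^ n - 1 := by
  obtain ⟨N, hN⟩ : ∃ N, ∀ k ∈ insert 1 s, ∀ i, k i < N := by
    refine ⟨(∑ k ∈ insert 1 s, ∑ i, k i) + 1, fun k hk i => Nat.lt_succ_of_le ?_⟩
    exact (Finset.single_le_sum (f := fun i => k i) (fun _ _ => Nat.zero_le _)
      (Finset.mem_univ i)).trans (Finset.single_le_sum (f := fun k : Fin n → ℕ => ∑ i, k i)
        (fun _ _ => Nat.zero_le _) hk)
  have hsub : insert 1 s ⊆ Fintype.piFinset fun _ : Fin n => Finset.range N := fun k hk =>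
    Fintype.mem_piFinset.2 fun i => Finset.mem_range.2 (hN k hk i)
  have hpos : ∀ k : Fin n → ℕ, 0 ≤ ∏ i, ((k i : ℝ) * exp (-(A * ((k i : ℝ) ^ 2 - 1)))) :=
    fun k => Finset.prod_nonneg fun i _ => by positivity
  have h1 := Finset.sum_le_sum_of_subset_of_nonneg hsub fun k _ _ => hpos k
  rw [← Finset.prod_univ_sum (fun _ => Finset.range N)
      fun _ m => (m : ℝ) * exp (-(A * ((m : ℝ) ^ 2 - 1))),
    ← Finset.add_sum_erase _ _ (Finset.mem_insert_self 1 s), Finset.erase_insert_eq_erase] at h1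
  have h2 : ∏ _i : Fin n, ∑ m ∈ Finset.range N, (m : ℝ) * exp (-(A * ((m : ℝ) ^ 2 - 1))) ≤
      (1 + 4 / A ^ 2) ^ n := by
    refine (Finset.prod_le_prod (fun _ _ => Finset.sum_nonneg fun _ _ => by positivity)
      fun _ _ => sum_range_mul_exp_le hA N).trans ?_
    simp
  simp only [Pi.one_apply, Nat.cast_one, one_pow, sub_self, mul_zero, neg_zero, exp_zero, mul_one,
    Finset.prod_const_one] at h1
  linarith

lemma exp_sineEigenvalue_le {a : Fin n → ℝ} (ha : ∀ i, 0 < a i) {L A : ℝ} (hA : 0 < A)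
    (hL : ∀ i, a i ≤ L) {k : Fin n → ℕ} (hk : ∀ i, k i ≠ 0) :
    exp (-sineEigenvalue a k * (A * L ^ 2)) ≤
      exp (-sineEigenvalue a 1 * (A * L ^ 2)) * ∏ i, exp (-(A * ((k i : ℝ) ^ 2 - 1))) := by
  rw [← exp_sum, ← exp_add, exp_le_exp, sineEigenvalue, sineEigenvalue, Finset.sum_neg_distrib]
  have : ∑ i, A * ((k i : ℝ) ^ 2 - 1) ≤ (∑ i, (k i * (π / (2 * a i))) ^ 2 -
      ∑ i, (((1 : Fin n → ℕ) i : ℕ) * (π / (2 * a i))) ^ 2) * (A * L ^ 2) := by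
    rw [← Finset.sum_sub_distrib, Finset.sum_mul]
    refine Finset.sum_le_sum fun i _ => ?_
    have h1 : (1 : ℝ) ≤ k i := by exact_mod_cast Nat.one_le_iff_ne_zero.2 (hk i)
    have h2 : 1 ≤ π / (2 * a i) * L := by
      rw [div_mul_eq_mul_div, one_le_div (by linarith [ha i])]
      nlinarith [pi_gt_three, ha i, hL i]
    have h3 : 1 ≤ (π / (2 * a i) * L) ^ 2 := one_le_pow₀ h2
    have h4 : 0 ≤ A * ((k i : ℝ) ^ 2 - 1) := mul_nonneg hA.le (by nlinarith)
    calc A * ((k i : ℝ) ^ 2 - 1) ≤ A * ((k i : ℝ) ^ 2 - 1) * (π / (2 * a i) * L) ^ 2 :=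
          le_mul_of_one_le_right h4 h3
      _ = _ := by simp; ring
  linarith

lemma abs_sum_exp_mul_sineMode_sub_le {a : Fin n → ℝ} (ha : ∀ i, 0 < a i) {L A : ℝ} (hA : 0 < A)
    (hL : ∀ i, a i ≤ L) (s : Finset (Fin n → ℕ)) (c : (Fin n → ℕ) → ℝ) {M : ℝ}
    (hc : ∀ k ∈ s, (∀ i, k i ≠ 0) → |c k| ≤ M) (hM : 0 ≤ M)
    {x : EuclideanSpace ℝ (Fin n)} (hx : x ∈ closedBox n a) :
    |∑ k ∈ s, c k * (exp (-sineEigenvalue a k * (A * L ^ 2)) * sineMode a k x) -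
      (if 1 ∈ s then c 1 else 0) * (exp (-sineEigenvalue a 1 * (A * L ^ 2)) * sineMode a 1 x)| ≤
    M * (exp (-sineEigenvalue a 1 * (A * L ^ 2)) * sineMode a 1 x) * ((1 + 4 / A ^ 2) ^ n - 1) := by
  have h1 : ∑ k ∈ s, c k * (exp (-sineEigenvalue a k * (A * L ^ 2)) * sineMode a k x) -
      (if 1 ∈ s then c 1 else 0) * (exp (-sineEigenvalue a 1 * (A * L ^ 2)) * sineMode a 1 x) =
      ∑ k ∈ s.erase 1, c k * (exp (-sineEigenvalue a k * (A * L ^ 2)) * sineMode a k x) := by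
    split_ifs with h
    · rw [← Finset.add_sum_erase _ _ h]
      ring
    · rw [Finset.erase_eq_of_notMem h]
      ring
  rw [h1]
  have hs0 := sineMode_one_nonneg ha hx
  have hD : 0 ≤ M * (exp (-sineEigenvalue a 1 * (A * L ^ 2)) * sineMode a 1 x) := by positivity
  calc _ ≤ ∑ k ∈ s.erase 1,
        |c k * (exp (-sineEigenvalue a k * (A * L ^ 2)) * sineMode a k x)| :=
        Finset.abs_sum_le_sum_abs _ _
    _ ≤ ∑ k ∈ s.erase 1, M * (exp (-sineEigenvalue a 1 * (A * L ^ 2)) * sineMode a 1 x) *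
          ∏ i, ((k i : ℝ) * exp (-(A * ((k i : ℝ) ^ 2 - 1)))) := by
        refine Finset.sum_le_sum fun k hk => ?_
        by_cases hk0 : ∀ i, k i ≠ 0
        · rw [abs_mul, abs_mul, abs_of_pos (exp_pos _), Finset.prod_mul_distrib]
          calc _ ≤ M * ((exp (-sineEigenvalue a 1 * (A * L ^ 2)) *
                ∏ i, exp (-(A * ((k i : ℝ) ^ 2 - 1)))) *
                ((∏ i, (k i : ℝ)) * sineMode a 1 x)) := by
                gcongr
                · exact hc k (Finset.mem_of_mem_erase hk) hk0
                · exact exp_sineEigenvalue_le ha hA hL hk0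
                · exact abs_sineMode_le ha k hx
            _ = _ := by ring
        · push Not at hk0
          obtain ⟨i, hi⟩ := hk0
          have : sineMode a k x = 0 := Finset.prod_eq_zero (Finset.mem_univ i) (by simp [hi])
          rw [this]
          simp only [mul_zero, abs_zero]
          exact mul_nonneg hD (Finset.prod_nonneg fun i _ => by positivity)
    _ ≤ _ := by
        rw [← Finset.mul_sum]
        exact mul_le_mul_of_nonneg_left (sum_erase_one_prod_mul_exp_le hA s) hD

lemma abs_coeff_le {a : Fin n → ℝ} (ha : ∀ i, 0 < a i) {f : EuclideanSpace ℝ (Fin n) → ℝ}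
    (hf : ContinuousOn f (closedBox n a)) (hf1 : ∫ x in box n a, f x ^ 2 ≤ 1)
    {s : Finset (Fin n → ℕ)} {c : (Fin n → ℕ) → ℝ} {ε : ℝ}
    (hc : ∀ x ∈ closedBox n a, |∑ k ∈ s, c k * sineMode a k x - f x| ≤ ε)
    {k : Fin n → ℕ} (hks : k ∈ s) (hk : ∀ i, k i ≠ 0) :
    |c k| ≤ 2 ^ n * (1 / sqrt (∏ i, a i) + ε) := by
  have hP : 0 < ∏ i, a i := Finset.prod_pos fun i _ => ha i
  set κ := sqrt (∏ i, a i)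
  have hκ0 : 0 < κ := sqrt_pos.2 hP
  have hκP : κ ^ 2 = ∏ i, a i := sq_sqrt hP.le
  have h1 := setIntegral_sum_mul_sineMode ha s c hk
  rw [if_pos hks] at h1
  have hbound : ∀ x ∈ closedBox n a, |(∑ l ∈ s, c l * sineMode a l x) * sineMode a k x| ≤
      κ / 2 * f x ^ 2 + (1 / (2 * κ) + ε) := by
    intro x hx
    rw [abs_mul]
    have e1 : |∑ l ∈ s, c l * sineMode a l x| ≤ |f x| + ε := by
      have := abs_sub_abs_le_abs_sub (∑ l ∈ s, c l * sineMode a l x) (f x)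
      linarith [hc x hx]
    have e2 : |f x| ≤ κ / 2 * f x ^ 2 + 1 / (2 * κ) := by
      have : κ / 2 * f x ^ 2 + 1 / (2 * κ) - |f x| = (κ * |f x| - 1) ^ 2 / (2 * κ) := by
        rw [← sq_abs (f x)]
        field_simp
        ring
      have : 0 ≤ (κ * |f x| - 1) ^ 2 / (2 * κ) := by positivity
      linarith
    calc _ ≤ (|f x| + ε) * 1 := by
          gcongr
          · linarith [abs_nonneg (∑ l ∈ s, c l * sineMode a l x)]
          · exact abs_sineMode_le_one _ _ _
      _ ≤ _ := by linarith
  have hint_on : IntegrableOn (fun x => κ / 2 * f x ^ 2 + (1 / (2 * κ) + ε)) (box n a) :=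
    integrableOn_box a ((continuousOn_const.mul (hf.pow 2)).add continuousOn_const)
  have hcont : Continuous fun x => (∑ l ∈ s, c l * sineMode a l x) * sineMode a k x :=
    (continuous_finsetSum s fun l _ => continuous_const.mul (continuous_sineMode a l)).mul
      (continuous_sineMode a k)
  have h2 : |c k| * κ ^ 2 ≤ ∫ x in box n a, (κ / 2 * f x ^ 2 + (1 / (2 * κ) + ε)) := by
    calc |c k| * κ ^ 2 = |∫ x in box n a, (∑ l ∈ s, c l * sineMode a l x) * sineMode a k x| := by
          rw [h1, abs_mul, abs_of_pos hP, hκP]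
      _ ≤ ∫ x in box n a, |(∑ l ∈ s, c l * sineMode a l x) * sineMode a k x| :=
          abs_integral_le_integral_abs
      _ ≤ _ := setIntegral_mono_on (integrableOn_box a hcont.abs.continuousOn) hint_on
          (measurableSet_box a) fun x hx => hbound x (box_subset_closedBox a hx)
  have hint2 : IntegrableOn (fun x => κ / 2 * f x ^ 2) (box n a) :=
    integrableOn_box a (continuousOn_const.mul (hf.pow 2))
  have hintc : IntegrableOn (fun _ : EuclideanSpace ℝ (Fin n) => 1 / (2 * κ) + ε) (box n a) :=
    integrableOn_box a continuousOn_const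
  rw [integral_add hint2 hintc, integral_const_mul, setIntegral_const,
    volume_real_box ha, smul_eq_mul, ← hκP] at h2
  have h3 : (1 : ℝ) ≤ 2 ^ n := one_le_pow₀ (by norm_num)
  have h4 : |c k| * κ ^ 2 ≤ 2 ^ n * (1 / κ + ε) * κ ^ 2 := by
    have e1 : κ / 2 * ∫ x in box n a, f x ^ 2 ≤ κ / 2 * 1 := by gcongr
    have e2 : 2 ^ n * κ ^ 2 * (1 / (2 * κ) + ε) = 2 ^ n * κ / 2 + 2 ^ n * κ ^ 2 * ε := by
      field_simp
    have e3 : 2 ^ n * (1 / κ + ε) * κ ^ 2 = 2 ^ n * κ + 2 ^ n * κ ^ 2 * ε := by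
      field_simp
    have e4 : κ ≤ 2 ^ n * κ := le_mul_of_one_le_left hκ0.le h3
    linarith
  exact le_of_mul_le_mul_right h4 (by positivity)

lemma le_coeff_one {a : Fin n → ℝ} (ha : ∀ i, 0 < a i) {f : EuclideanSpace ℝ (Fin n) → ℝ}
    (hf : ContinuousOn f (closedBox n a)) {s : Finset (Fin n → ℕ)} {c : (Fin n → ℕ) → ℝ} {ε : ℝ}
    (hc : ∀ x ∈ closedBox n a, |∑ k ∈ s, c k * sineMode a k x - f x| ≤ ε) :
    (∫ x in box n a, f x * sineMode a 1 x) / (∏ i, a i) - 2 ^ n * ε ≤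
      if 1 ∈ s then c 1 else 0 := by
  have hP : 0 < ∏ i, a i := Finset.prod_pos fun i _ => ha i
  have h1 := setIntegral_sum_mul_sineMode ha s c (k := 1) (fun i => by simp)
  have hcont : Continuous fun x => (∑ l ∈ s, c l * sineMode a l x) * sineMode a 1 x :=
    (continuous_finsetSum s fun l _ => continuous_const.mul (continuous_sineMode a l)).mul
      (continuous_sineMode a 1)
  have hi1 : IntegrableOn (fun x => f x * sineMode a 1 x) (box n a) :=
    integrableOn_box a (hf.mul (continuous_sineMode a 1).continuousOn)
  have hi2 : IntegrableOn (fun _ : EuclideanSpace ℝ (Fin n) => ε) (box n a) :=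
    integrableOn_box a continuousOn_const
  have h2 : ∫ x in box n a, (f x * sineMode a 1 x - ε) ≤
      ∫ x in box n a, (∑ l ∈ s, c l * sineMode a l x) * sineMode a 1 x := by
    refine setIntegral_mono_on (hi1.sub hi2) (integrableOn_box a hcont.continuousOn)
      (measurableSet_box a) fun x hx => ?_
    have e1 := hc x (box_subset_closedBox a hx)
    have e2 := abs_sineMode_le_one a 1 x
    have e3 : |(∑ k ∈ s, c k * sineMode a k x - f x) * sineMode a 1 x| ≤ ε * 1 := by
      rw [abs_mul]
      exact mul_le_mul e1 e2 (abs_nonneg _) ((abs_nonneg _).trans e1)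
    have := (abs_le.1 e3).1
    linarith
  rw [h1, integral_sub hi1 hi2, setIntegral_const, volume_real_box ha, smul_eq_mul] at h2
  rw [sub_le_iff_le_add, div_le_iff₀ hP]
  linarith

lemma le_of_forall_pos_le_add_mul {X Y K : ℝ} (h : ∀ ε > 0, X ≤ Y + ε * K) : X ≤ Y := by
  have hc : Continuous fun ε : ℝ => Y + ε * K := by fun_prop
  have ht : Tendsto (fun ε : ℝ => Y + ε * K) (𝓝[>] 0) (𝓝 Y) := by
    simpa using (hc.tendsto 0).mono_left nhdsWithin_le_nhds
  exact ge_of_tendsto ht (eventually_mem_nhdsWithin.mono fun ε hε => h ε hε)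

end Estimates

/-! ### Positive eigenfunctions of a domain between two boxes -/

section Comparison

variable {n : ℕ}

/-- `p` is a continuous function on `ℝⁿ` that vanishes off `U` and is a positive eigenfunction of
the Laplacian on `U`, with eigenvalue `lam`. -/
structure IsPositiveEigenfunction (U : Set (EuclideanSpace ℝ (Fin n))) (lam : ℝ)
    (p : EuclideanSpace ℝ (Fin n) → ℝ) : Prop where
  isOpen : IsOpen U
  continuous : Continuous p
  contDiffAt : ∀ x ∈ U, ContDiffAt ℝ 2 p x
  eigenEq : ∀ x ∈ U, laplacian p x = -lam * p x
  pos : ∀ x ∈ U, 0 < p x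
  eq_zero : ∀ x ∉ U, p x = 0

lemma IsPrincipalDirichletEigenfunction.indicator {U : Set (EuclideanSpace ℝ (Fin n))}
    {φ : EuclideanSpace ℝ (Fin n) → ℝ} (h : IsPrincipalDirichletEigenfunction U φ)
    (hU : IsOpen U) :
    IsPositiveEigenfunction U (dirichletEigenvalue n U) (U.indicator φ) := by
  have heq : ∀ x ∈ U, U.indicator φ =ᶠ[𝓝 x] φ := fun x hx => by
    filter_upwards [hU.mem_nhds hx] with y hy using indicator_of_mem hy φ
  refine ⟨hU, ?_, fun x hx => ?_, fun x hx => ?_, fun x hx => ?_, fun x hx => ?_⟩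
  · classical
    rw [← piecewise_eq_indicator]
    exact continuous_piecewise h.vanishes h.continuousOn continuousOn_const
  · exact (((h.smooth.contDiffAt (hU.mem_nhds hx)).of_le
      (WithTop.coe_le_coe.2 (le_top : (2 : ℕ∞) ≤ ⊤))).congr_of_eventuallyEq (heq x hx))
  · rw [laplacian_congr (heq x hx), h.eigenEq x hx, indicator_of_mem hx]
  · rw [indicator_of_mem hx]; exact h.pos x hx
  · exact indicator_of_notMem hx φ

variable {U : Set (EuclideanSpace ℝ (Fin n))} {lam : ℝ} {p : EuclideanSpace ℝ (Fin n) → ℝ}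

lemma IsPositiveEigenfunction.nonneg (hp : IsPositiveEigenfunction U lam p)
    (x : EuclideanSpace ℝ (Fin n)) : 0 ≤ p x := by
  by_cases hx : x ∈ U
  · exact (hp.pos x hx).le
  · exact (hp.eq_zero x hx).ge

lemma IsPositiveEigenfunction.eq_zero_of_mem_frontier (hp : IsPositiveEigenfunction U lam p)
    {x : EuclideanSpace ℝ (Fin n)} (hx : x ∈ frontier U) : p x = 0 := by
  rw [hp.isOpen.frontier_eq] at hx
  exact hp.eq_zero x hx.2

lemma IsPositiveEigenfunction.isCaloricOn (hp : IsPositiveEigenfunction U lam p)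
    {V : Set (EuclideanSpace ℝ (Fin n))} (hV : V ⊆ U) :
    IsCaloricOn V fun t x => exp (-lam * t) * p x :=
  isCaloricOn_exp_mul hp.continuous (fun x hx => hp.contDiffAt x (hV hx))
    fun x hx => hp.eigenEq x (hV hx)

lemma sineEigenvalue_one_eq (a : Fin n → ℝ) :
    sineEigenvalue a 1 = π ^ 2 / 4 * ∑ i, 1 / a i ^ 2 := by
  rw [sineEigenvalue, Finset.mul_sum]
  refine Finset.sum_congr rfl fun i _ => ?_
  simp only [Pi.one_apply, Nat.cast_one, one_mul, div_pow, mul_pow]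
  ring

lemma sineEigenvalue_const_mul (r : ℝ) (a : Fin n → ℝ) :
    sineEigenvalue (fun i => r * a i) 1 = sineEigenvalue a 1 / r ^ 2 := by
  rw [sineEigenvalue_one_eq, sineEigenvalue_one_eq, mul_div_assoc, Finset.sum_div]
  congr 1
  refine Finset.sum_congr rfl fun i _ => ?_
  rw [mul_pow, div_div, mul_comm]

lemma IsPositiveEigenfunction.sineEigenvalue_le (hp : IsPositiveEigenfunction U lam p)
    (hne : U.Nonempty) {b : Fin n → ℝ} (hb : ∀ i, 0 < b i) (hU : U ⊆ box n b) :
    sineEigenvalue b 1 ≤ lam := by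
  have key : ∀ ε > 0, sineEigenvalue b 1 ≤ lam * (1 + ε) ^ 2 := by
    intro ε hε
    have hrb : ∀ i, 0 < (1 + ε) * b i := fun i => mul_pos (by linarith) (hb i)
    have := eigenvalue_le_of_pos (q := sineMode (fun i => (1 + ε) * b i) 1)
      hp.isOpen ((isBounded_box b).subset hU) hne hp.continuous
      (continuous_sineMode _ _).continuousOn hp.contDiffAt
      (fun x _ => (contDiff_sineMode _ _).contDiffAt) hp.eigenEq
      (fun x _ => laplacian_sineMode _ _ x) hp.pos
      (fun x hx => hp.eq_zero_of_mem_frontier hx)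
      (fun x hx => sineMode_one_pos hrb fun i => by
        have := closure_box_subset b (closure_mono hU hx) i
        nlinarith [hb i])
    rwa [sineEigenvalue_const_mul, div_le_iff₀ (by positivity)] at this
  have hc : Continuous fun ε : ℝ => lam * (1 + ε) ^ 2 := by fun_prop
  have ht : Tendsto (fun ε : ℝ => lam * (1 + ε) ^ 2) (𝓝[>] 0) (𝓝 lam) := by
    simpa using (hc.tendsto 0).mono_left nhdsWithin_le_nhds
  exact ge_of_tendsto ht (eventually_mem_nhdsWithin.mono fun ε hε => key ε hε)

lemma IsPositiveEigenfunction.le_sineEigenvalue (hp : IsPositiveEigenfunction U lam p)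
    {a : Fin n → ℝ} (ha : ∀ i, 0 < a i) (hU : box n a ⊆ U) :
    lam ≤ sineEigenvalue a 1 := by
  have key : ∀ r ∈ Ioo (0 : ℝ) 1, lam * r ^ 2 ≤ sineEigenvalue a 1 := by
    intro r hr
    have hra : ∀ i, 0 < r * a i := fun i => mul_pos hr.1 (ha i)
    have hsub : closure (box n fun i => r * a i) ⊆ U := fun x hx => hU fun i => by
      have := closure_box_subset _ hx i
      nlinarith [ha i, hr.2]
    have := eigenvalue_le_of_pos (p := sineMode (fun i => r * a i) 1) (q := p)
      (isOpen_box _) (isBounded_box _) ⟨0, fun i => by simpa using hra i⟩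
      (continuous_sineMode _ _) hp.continuous.continuousOn
      (fun x _ => (contDiff_sineMode _ _).contDiffAt)
      (fun x hx => hp.contDiffAt x (hsub (subset_closure hx)))
      (fun x _ => laplacian_sineMode _ _ x)
      (fun x hx => hp.eigenEq x (hsub (subset_closure hx)))
      (fun x hx => sineMode_one_pos hra hx)
      (fun x hx => sineMode_eq_zero_of_mem_frontier hra 1 hx)
      (fun x hx => hp.pos x (hsub hx))
    rwa [sineEigenvalue_const_mul, le_div_iff₀ (pow_pos hr.1 2)] at this
  have hc : Continuous fun r : ℝ => lam * r ^ 2 := by fun_prop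
  have ht : Tendsto (fun r : ℝ => lam * r ^ 2) (𝓝[<] 1) (𝓝 lam) := by
    simpa using (hc.tendsto 1).mono_left nhdsWithin_le_nhds
  refine le_of_tendsto ht ?_
  filter_upwards [Ioo_mem_nhdsLT (zero_lt_one (α := ℝ))] with r hr using key r hr

lemma continuous_max_sub_div_sineMode (hp : IsPositiveEigenfunction U lam p)
    {b : Fin n → ℝ} (hb : ∀ i, 0 < b i) (hU : U ⊆ box n b) {ε : ℝ} (hε : 0 < ε) :
    Continuous fun x => max (p x - ε) 0 / sineMode b 1 x := by
  rw [continuous_iff_continuousAt]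
  intro x
  by_cases hx : x ∈ U
  · exact ((hp.continuous.sub continuous_const).max continuous_const).continuousAt.div
      (continuous_sineMode b 1).continuousAt (sineMode_one_pos hb (hU hx)).ne'
  · have h0 : ∀ᶠ y in 𝓝 x, p y < ε :=
      hp.continuous.continuousAt.eventually_lt continuousAt_const (by simpa [hp.eq_zero x hx])
    refine (continuousAt_const (y := (0 : ℝ))).congr ?_
    filter_upwards [h0] with y hy
    rw [max_eq_right (by linarith), zero_div]

/-- The heat semigroup of an outer box controls the eigenfunction from above. -/
lemma IsPositiveEigenfunction.exp_mul_le (hp : IsPositiveEigenfunction U lam p)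
    {b : Fin n → ℝ} (hb : ∀ i, 0 < b i) (hU : U ⊆ box n b) (hp1 : ∫ x in box n b, p x ^ 2 ≤ 1)
    {L A : ℝ} (hA : 0 < A) (hL : ∀ i, b i ≤ L) {x : EuclideanSpace ℝ (Fin n)} (hx : x ∈ U) :
    exp (-lam * (A * L ^ 2)) * p x ≤ 2 ^ n * (1 + 4 / A ^ 2) ^ n / sqrt (∏ i, b i) *
      (exp (-sineEigenvalue b 1 * (A * L ^ 2)) * sineMode b 1 x) := by
  set D := exp (-sineEigenvalue b 1 * (A * L ^ 2)) * sineMode b 1 x with hD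
  have hD0 : 0 ≤ D := mul_nonneg (exp_pos _).le (sineMode_one_pos hb (hU hx)).le
  refine le_of_forall_pos_le_add_mul (K := 2 ^ n * (1 + 4 / A ^ 2) ^ n * D + 2) fun ε hε => ?_
  set f := fun y => max (p y - ε) 0 with hf
  have hfc : Continuous f := (hp.continuous.sub continuous_const).max continuous_const
  obtain ⟨s, c, hsc⟩ := exists_sineMode_approx hb
    (continuous_max_sub_div_sineMode hp hb hU hε).continuousOn hε
  have hfs : ∀ y ∈ closedBox n b, |∑ k ∈ s, c k * sineMode b k y - f y| ≤ ε := by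
    intro y hy
    convert hsc y hy using 3
    by_cases hyU : y ∈ U
    · rw [mul_div_cancel₀ _ (sineMode_one_pos hb (hU hyU)).ne']
    · have : f y = 0 := by simp [hf, hp.eq_zero y hyU, hε.le]
      simp only [hf] at this ⊢
      simp [this]
  have hf1 : ∫ y in box n b, f y ^ 2 ≤ 1 := by
    refine le_trans (setIntegral_mono_on (integrableOn_box b (hfc.pow 2).continuousOn)
      (integrableOn_box b (hp.continuous.pow 2).continuousOn) (measurableSet_box b)
      fun y _ => ?_) hp1
    exact pow_le_pow_left₀ (le_max_right _ _) (max_le (by linarith) (hp.nonneg y)) 2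
  set M := 2 ^ n * (1 / sqrt (∏ i, b i) + ε) with hM
  have hM0 : 0 ≤ M := by positivity
  have hcM : ∀ k ∈ s, (∀ i, k i ≠ 0) → |c k| ≤ M := fun k hk hk0 =>
    abs_coeff_le hb hfc.continuousOn hf1 hfs hk hk0
  have hbd : Bornology.IsBounded (box n b) := isBounded_box b
  have hsum : ∀ V, IsCaloricOn V fun t y =>
      ∑ k ∈ s, c k * (exp (-sineEigenvalue b k * t) * sineMode b k y) := fun V =>
    IsCaloricOn.sum s fun k => (isCaloricOn_sineMode V b k).const_mul (c k)
  have hcal1 := (hsum (box n b)).add (IsCaloricOn.const (box n b) ε)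
  have hbox : ∀ t, 0 ≤ t → ∀ y ∈ closure (box n b),
      0 ≤ ∑ k ∈ s, c k * (exp (-sineEigenvalue b k * t) * sineMode b k y) + ε := by
    intro t ht y hy
    refine hcal1.nonneg (isOpen_box b) hbd (fun z hz => ?_) (fun r _ z hz => ?_) ht hy
    · simp only [mul_zero, exp_zero, one_mul]
      have h1 := (abs_le.1 (hfs z (closure_box_subset b hz))).1
      have h2 : 0 ≤ f z := le_max_right _ _
      linarith
    · simp [sineMode_eq_zero_of_mem_frontier hb _ hz, hε.le]
  have hcal2 := ((hsum U).add (IsCaloricOn.const U (2 * ε))).add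
    ((hp.isCaloricOn subset_rfl).const_mul (-1))
  have hmain := hcal2.nonneg hp.isOpen (hbd.subset hU) (fun z hz => ?_) (fun r hr z hz => ?_)
    (show 0 ≤ A * L ^ 2 by positivity) (subset_closure hx)
  · have htail := (abs_le.1 (abs_sum_exp_mul_sineMode_sub_le hb hA hL s c hcM hM0
      (box_subset_closedBox b (hU hx)))).2
    rw [← hD] at htail
    have hc1 : (if 1 ∈ s then c 1 else 0) * D ≤ M * D := by
      refine mul_le_mul_of_nonneg_right ?_ hD0
      split_ifs with h
      · exact (le_abs_self _).trans (hcM 1 h fun i => by simp)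
      · exact hM0
    have e1 : M * D * (1 + 4 / A ^ 2) ^ n = 2 ^ n * (1 + 4 / A ^ 2) ^ n / sqrt (∏ i, b i) * D +
        ε * (2 ^ n * (1 + 4 / A ^ 2) ^ n * D) := by
      rw [hM]; ring
    linarith
  · simp only [mul_zero, exp_zero, one_mul]
    have h1 := (abs_le.1 (hfs z (closure_box_subset b (closure_mono hU hz)))).1
    have h2 : p z - ε ≤ f z := le_max_left _ _
    linarith
  · have h1 := hbox r hr z (closure_mono hU (frontier_subset_closure hz))
    rw [hp.eq_zero_of_mem_frontier hz]
    linarith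

/-- The heat semigroup of an inner box controls the eigenfunction from below. -/
lemma IsPositiveEigenfunction.le_exp_mul (hp : IsPositiveEigenfunction U lam p)
    {a : Fin n → ℝ} (ha : ∀ i, 0 < a i) (hU : box n a ⊆ U) (hp1 : ∫ x in box n a, p x ^ 2 ≤ 1)
    {L A : ℝ} (hA : 0 < A) (hL : ∀ i, a i ≤ L) {x : EuclideanSpace ℝ (Fin n)}
    (hx : x ∈ box n a) :
    ((∫ y in box n a, p y * sineMode a 1 y ^ 2) / (∏ i, a i) -
      2 ^ n * ((1 + 4 / A ^ 2) ^ n - 1) / sqrt (∏ i, a i)) *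
      (exp (-sineEigenvalue a 1 * (A * L ^ 2)) * sineMode a 1 x) ≤
    exp (-lam * (A * L ^ 2)) * p x := by
  set D := exp (-sineEigenvalue a 1 * (A * L ^ 2)) * sineMode a 1 x with hD
  have hD0 : 0 ≤ D := mul_nonneg (exp_pos _).le (sineMode_one_pos ha hx).le
  refine le_of_forall_pos_le_add_mul (K := 2 ^ n * (1 + 4 / A ^ 2) ^ n * D + 1) fun ε hε => ?_
  set f := fun y => sineMode a 1 y * p y with hf
  have hfc : Continuous f := (continuous_sineMode a 1).mul hp.continuous
  obtain ⟨s, c, hsc⟩ := exists_sineMode_approx ha hp.continuous.continuousOn hε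
  have hfp : ∀ y, |f y| ≤ p y := fun y => by
    rw [hf, abs_mul, abs_of_nonneg (hp.nonneg y)]
    exact mul_le_of_le_one_left (hp.nonneg y) (abs_sineMode_le_one _ _ _)
  have hf1 : ∫ y in box n a, f y ^ 2 ≤ 1 := by
    refine le_trans (setIntegral_mono_on (integrableOn_box a (hfc.pow 2).continuousOn)
      (integrableOn_box a (hp.continuous.pow 2).continuousOn) (measurableSet_box a)
      fun y _ => ?_) hp1
    rw [← sq_abs (f y)]
    exact pow_le_pow_left₀ (abs_nonneg _) (hfp y) 2
  set M := 2 ^ n * (1 / sqrt (∏ i, a i) + ε) with hM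
  have hM0 : 0 ≤ M := by positivity
  have hcM : ∀ k ∈ s, (∀ i, k i ≠ 0) → |c k| ≤ M := fun k hk hk0 =>
    abs_coeff_le ha hfc.continuousOn hf1 hsc hk hk0
  have hsum : IsCaloricOn (box n a) fun t y =>
      ∑ k ∈ s, c k * (exp (-sineEigenvalue a k * t) * sineMode a k y) :=
    IsCaloricOn.sum s fun k => (isCaloricOn_sineMode (box n a) a k).const_mul (c k)
  have hcal := ((hp.isCaloricOn hU).add (IsCaloricOn.const (box n a) ε)).add (hsum.const_mul (-1))
  have hmain := hcal.nonneg (isOpen_box a) (isBounded_box a) (fun z hz => ?_) (fun r hr z hz => ?_)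
    (show 0 ≤ A * L ^ 2 by positivity) (subset_closure hx)
  · have htail := (abs_le.1 (abs_sum_exp_mul_sineMode_sub_le ha hA hL s c hcM hM0
      (box_subset_closedBox a hx))).1
    rw [← hD] at htail
    have hc1 := mul_le_mul_of_nonneg_right (le_coeff_one ha hfc.continuousOn hsc) hD0
    have e0 : ∀ y, f y * sineMode a 1 y = p y * sineMode a 1 y ^ 2 := fun y => by
      rw [hf]; ring
    simp only [e0] at hc1
    have e1 : M * D * ((1 + 4 / A ^ 2) ^ n - 1) + 2 ^ n * ε * D =
        2 ^ n * ((1 + 4 / A ^ 2) ^ n - 1) / sqrt (∏ i, a i) * D +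
        ε * (2 ^ n * (1 + 4 / A ^ 2) ^ n * D) := by
      rw [hM]; ring
    linarith
  · simp only [mul_zero, exp_zero, one_mul]
    have h1 := (abs_le.1 (hsc z (closure_box_subset a hz))).2
    have h2 : sineMode a 1 z * p z ≤ p z := (le_abs_self _).trans (hfp z)
    linarith
  · simp only [sineMode_eq_zero_of_mem_frontier ha _ hz, mul_zero, Finset.sum_const_zero, add_zero]
    have := mul_nonneg (exp_pos (-lam * r)).le (hp.nonneg z)
    linarith

/-- An eigenfunction bounded by a multiple of the natural height keeps a definite part of its mass
away from the boundary of the outer box. -/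
lemma IsPositiveEigenfunction.le_setIntegral_mul_sineMode_sq
    (hp : IsPositiveEigenfunction U lam p) {a b : Fin n → ℝ} (ha : ∀ i, 0 < a i)
    (hb : ∀ i, 0 < b i) (hab : ∀ i, a i ≤ b i) {H η : ℝ} (hH : 0 < H)
    (hη : η ∈ Ioo (0 : ℝ) 1) (hba : ∀ i, b i * (1 - η / 2) ≤ a i)
    (hHη : 2 ^ n * H ^ 2 * (n * η) ≤ 1 / 2)
    (hpH : ∀ x ∈ box n b, p x ≤ H / sqrt (∏ i, b i)) (hp1 : ∫ x in box n b, p x ^ 2 = 1) :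
    (η / 2) ^ (2 * n) / (2 * H) * sqrt (∏ i, a i) ≤
      ∫ x in box n a, p x * sineMode a 1 x ^ 2 := by
  have hP : 0 < ∏ i, b i := Finset.prod_pos fun i _ => hb i
  set κ := sqrt (∏ i, b i)
  have hκ0 : 0 < κ := sqrt_pos.2 hP
  have hκP : κ ^ 2 = ∏ i, b i := sq_sqrt hP.le
  have hd : ∀ i, 0 < (1 - η) * b i := fun i => mul_pos (by linarith [hη.2]) (hb i)
  set I := box n fun i => (1 - η) * b i
  have hIb : I ⊆ box n b := fun x hx i => (hx i).trans_le (by nlinarith [hb i, hη.1])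
  have hIa : I ⊆ box n a := fun x hx i =>
    (hx i).trans_le (le_trans (by nlinarith [hb i, hη.1]) (hba i))
  have hpc2 : Continuous fun x => p x ^ 2 := hp.continuous.pow 2
  have hmass : 1 / 2 ≤ ∫ x in I, p x ^ 2 := by
    have h1 : ∫ x in I, (H ^ 2 / κ ^ 2 - p x ^ 2) ≤ ∫ x in box n b, (H ^ 2 / κ ^ 2 - p x ^ 2) := by
      refine setIntegral_mono_set
        (integrableOn_box b (continuous_const.sub hpc2).continuousOn) ?_ hIb.eventuallyLE
      refine (ae_restrict_iff' (measurableSet_box b)).2 (Eventually.of_forall fun x hx => ?_)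
      have := pow_le_pow_left₀ (hp.nonneg x) (hpH x hx) 2
      rw [div_pow] at this
      simpa using this
    rw [integral_sub (integrableOn_box _ continuousOn_const) (integrableOn_box _ hpc2.continuousOn),
      integral_sub (integrableOn_box _ continuousOn_const) (integrableOn_box _ hpc2.continuousOn),
      setIntegral_const, setIntegral_const, volume_real_box hb, volume_real_box hd, hp1,
      Finset.prod_mul_distrib, smul_eq_mul, smul_eq_mul, ← hκP] at h1
    simp only [Finset.prod_const, Finset.card_univ, Fintype.card_fin] at h1
    have hB : 1 - n * η ≤ (1 - η) ^ n := by
      have := one_add_mul_le_pow (a := -η) (by linarith [hη.2]) n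
      simpa [sub_eq_add_neg] using this
    have e1 : 2 ^ n * ((1 - η) ^ n * κ ^ 2) * (H ^ 2 / κ ^ 2) = 2 ^ n * H ^ 2 * (1 - η) ^ n := by
      field_simp
    have e2 : 2 ^ n * κ ^ 2 * (H ^ 2 / κ ^ 2) = 2 ^ n * H ^ 2 := by
      field_simp
    rw [e1, e2] at h1
    have h2 := mul_le_mul_of_nonneg_left hB (by positivity : 0 ≤ 2 ^ n * H ^ 2)
    linarith
  have hsine : ∀ x ∈ I, (η / 2) ^ n ≤ sineMode a 1 x := by
    intro x hx
    rw [sineMode_one_eq]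
    calc (η / 2) ^ n = ∏ _i : Fin n, η / 2 := by
          rw [Finset.prod_const, Finset.card_univ, Fintype.card_fin]
      _ ≤ _ := by
        refine Finset.prod_le_prod (fun _ _ => by linarith [hη.1]) fun i _ => ?_
        refine le_trans ?_ (cos_bounds (ha i) (hIa hx i).le).1
        have : |x i| / a i ≤ 1 - η / 2 := by
          rw [div_le_iff₀ (ha i)]
          have h1 := hx i
          have h2 := mul_le_mul_of_nonneg_left (hba i) (by linarith [hη.2] : 0 ≤ 1 - η / 2)
          nlinarith [hb i, sq_nonneg η, mul_nonneg (hb i).le (sq_nonneg η)]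
        linarith
  have hcont : Continuous fun x => p x * sineMode a 1 x ^ 2 :=
    hp.continuous.mul ((continuous_sineMode a 1).pow 2)
  have hκa : sqrt (∏ i, a i) ≤ κ :=
    sqrt_le_sqrt (Finset.prod_le_prod (fun i _ => (ha i).le) fun i _ => hab i)
  have hη0 : 0 ≤ η / 2 := by linarith [hη.1]
  calc (η / 2) ^ (2 * n) / (2 * H) * sqrt (∏ i, a i)
      ≤ (η / 2) ^ (2 * n) / (2 * H) * κ := by gcongr
    _ = κ / H * (η / 2) ^ (2 * n) * (1 / 2) := by field_simp
    _ ≤ κ / H * (η / 2) ^ (2 * n) * ∫ x in I, p x ^ 2 := by gcongr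
    _ = ∫ x in I, κ / H * (η / 2) ^ (2 * n) * p x ^ 2 := (integral_const_mul _ _).symm
    _ ≤ ∫ x in I, p x * sineMode a 1 x ^ 2 := by
        refine setIntegral_mono_on (integrableOn_box _ (continuous_const.mul hpc2).continuousOn)
          (integrableOn_box _ hcont.continuousOn) (measurableSet_box _) fun x hx => ?_
        have h1 : κ / H * p x ^ 2 ≤ p x := by
          have h2 := mul_le_mul_of_nonneg_left (hpH x (hIb hx)) (hp.nonneg x)
          rw [div_mul_eq_mul_div, div_le_iff₀ hH]
          rw [← mul_div_assoc, le_div_iff₀ hκ0] at h2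
          linarith
        have h3 : (η / 2) ^ (2 * n) ≤ sineMode a 1 x ^ 2 := by
          rw [mul_comm, pow_mul]
          exact pow_le_pow_left₀ (by positivity) (hsine x hx) 2
        calc _ = κ / H * p x ^ 2 * (η / 2) ^ (2 * n) := by ring
          _ ≤ p x * sineMode a 1 x ^ 2 :=
            mul_le_mul h1 h3 (by positivity) (hp.nonneg x)
    _ ≤ _ := by
        refine setIntegral_mono_set (integrableOn_box a hcont.continuousOn) ?_ hIa.eventuallyLE
        exact Eventually.of_forall fun x => mul_nonneg (hp.nonneg x) (sq_nonneg _)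

lemma sineMode_one_le_of_abs_lt {a b : Fin n → ℝ} (ha : ∀ i, 0 < a i) (hab : ∀ i, a i ≤ b i)
    {x : EuclideanSpace ℝ (Fin n)} (hx : ∀ i, |x i| < a i - (b i - a i)) :
    sineMode b 1 x ≤ π ^ n * sineMode a 1 x := by
  have hxa : ∀ i, |x i| ≤ a i := fun i => by linarith [hx i, hab i]
  have hb : ∀ i, 0 < b i := fun i => (ha i).trans_le (hab i)
  rw [sineMode_one_eq, sineMode_one_eq]
  calc _ ≤ ∏ i, (π * cos (π * x i / (2 * a i))) := by
        refine Finset.prod_le_prod (fun i _ => ?_) fun i _ => ?_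
        · exact le_trans (sub_nonneg.2 ((div_le_one (hb i)).2 ((hxa i).trans (hab i))))
            (cos_bounds (hb i) ((hxa i).trans (hab i))).1
        · have h1 := (cos_bounds (hb i) ((hxa i).trans (hab i))).2
          have h2 := (cos_bounds (ha i) (hxa i)).1
          have h3 : 1 - |x i| / b i ≤ 2 * (1 - |x i| / a i) := by
            have e1 : 1 - |x i| / b i = (b i - |x i|) / b i := by
              rw [sub_div, div_self (hb i).ne']
            have e2 : 2 * (1 - |x i| / a i) = 2 * (a i - |x i|) / a i := by
              rw [mul_div_assoc, sub_div, div_self (ha i).ne']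
            rw [e1, e2]
            exact div_le_div₀ (by linarith [hxa i]) (by linarith [hx i]) (ha i) (hab i)
          nlinarith [pi_pos]
    _ = _ := by simp [Finset.prod_mul_distrib]

lemma exists_pow_sub_one_le (n : ℕ) {c : ℝ} (hc : 0 < c) :
    ∃ A > (0 : ℝ), 2 ^ n * ((1 + 4 / A ^ 2) ^ n - 1) ≤ c := by
  have h1 : Tendsto (fun A : ℝ => 4 / A ^ 2) atTop (𝓝 0) :=
    tendsto_const_nhds.div_atTop (tendsto_pow_atTop (by norm_num))
  have h2 : Tendsto (fun A : ℝ => 2 ^ n * ((1 + 4 / A ^ 2) ^ n - 1)) atTop (𝓝 0) := by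
    simpa using (((h1.const_add 1).pow n).sub_const 1).const_mul (2 ^ n : ℝ)
  obtain ⟨A, hA, hA0⟩ := ((h2.eventually_le_const hc).and (eventually_gt_atTop 0)).exists
  exact ⟨A, hA0, hA⟩

end Comparison

theorem stmt_11 (n : ℕ) (hn : 1 ≤ n) (C₁ : ℝ) (hC₁ : 0 < C₁) :
    ∃ δ > (1 : ℝ), ∃ c > (0 : ℝ), ∃ C ≥ (1 : ℝ),
      ∀ a b : Fin n → ℝ, (∀ i, 0 < a i) → (∀ i, 0 < b i) →
        box n a ⊆ box n b →
        (∀ i j, 1 / (a i) ^ 2 - 1 / (b i) ^ 2 ≤ C₁ / (b j) ^ 2) →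
        (∀ i, b i / δ ≤ a i) →
        ∀ U : Set (EuclideanSpace ℝ (Fin n)), IsOpen U → IsConnected U →
          box n a ⊆ U → U ⊆ box n b →
          ∀ φ : EuclideanSpace ℝ (Fin n) → ℝ, IsPrincipalDirichletEigenfunction U φ →
            ∀ x : EuclideanSpace ℝ (Fin n), (∀ i, |x i| < a i - (b i - a i)) →
              c * boxEigenfunction n a x ≤ φ x ∧ φ x ≤ C * boxEigenfunction n a x := by
  have hn' : (1 : ℝ) ≤ n := by exact_mod_cast hn
  set K := π ^ 2 / 4 * (n * C₁) with hK
  have hK0 : 0 ≤ K := by positivity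
  set H := 10 ^ n * exp K with hH
  have hH1 : 1 ≤ H := one_le_mul_of_one_le_of_one_le (one_le_pow₀ (by norm_num)) (one_le_exp hK0)
  have hH0 : 0 < H := by linarith
  have hden : 2 ≤ 2 * (n * (2 ^ n * H ^ 2)) := by
    have h1 : (1 : ℝ) ≤ 2 ^ n * H ^ 2 :=
      one_le_mul_of_one_le_of_one_le (one_le_pow₀ (by norm_num)) (one_le_pow₀ hH1)
    have := one_le_mul_of_one_le_of_one_le hn' h1
    linarith
  set η := 1 / (2 * (n * (2 ^ n * H ^ 2))) with hη
  have hηI : η ∈ Ioo (0 : ℝ) 1 := by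
    constructor
    · positivity
    · rw [hη, div_lt_one (by linarith)]
      linarith
  have hHη : 2 ^ n * H ^ 2 * (n * η) ≤ 1 / 2 := by
    rw [hη]
    apply le_of_eq
    have : (n : ℝ) ≠ 0 := by linarith
    field_simp
  set c₀ := (η / 2) ^ (2 * n) / (2 * H)
  have hη0 := hηI.1
  have hc₀0 : 0 < c₀ := by positivity
  obtain ⟨A, hA, hAc⟩ := exists_pow_sub_one_le n (half_pos hc₀0)
  have hδ : 0 < 1 - η / 2 := by linarith [hηI.2]
  refine ⟨1 / (1 - η / 2), ?_, exp (-(A * K)) * (c₀ / 2), by positivity, H * π ^ n, ?_, ?_⟩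
  · rw [gt_iff_lt, lt_div_iff₀ hδ]
    linarith
  · exact one_le_mul_of_one_le_of_one_le hH1 (one_le_pow₀ (by linarith [pi_gt_three]))
  intro a b ha hb hbox hgap hratio U hU _ haU hUb φ hφ x hx
  have hab := le_of_box_subset_box ha hb hbox
  have hba : ∀ i, b i * (1 - η / 2) ≤ a i := fun i => by simpa using hratio i
  have hxa : x ∈ box n a := fun i => by linarith [hx i, hab i]
  have hxU := haU hxa
  have : Nonempty (Fin n) := ⟨⟨0, hn⟩⟩
  obtain ⟨j, hj⟩ := Finite.exists_max b
  have hp := hφ.indicator hU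
  set lam := dirichletEigenvalue n U
  set p := U.indicator φ with hpdef
  have hpx : p x = φ x := indicator_of_mem hxU φ
  rw [← hpx, boxEigenfunction_eq ha]
  have hp1 : ∫ y in box n b, p y ^ 2 = 1 := by
    rw [← hφ.normalized]
    have h1 : ∫ y in box n b, p y ^ 2 = ∫ y in U, p y ^ 2 := by
      refine (setIntegral_eq_of_subset_of_forall_sdiff_eq_zero (measurableSet_box b) hUb
        fun y hy => ?_)
      rw [hp.eq_zero y hy.2]
      norm_num
    rw [h1]
    refine setIntegral_congr_fun hU.measurableSet fun y hy => ?_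
    simp only [hpdef, indicator_of_mem hy]
  have hp1a : ∫ y in box n a, p y ^ 2 ≤ 1 := by
    rw [← hp1]
    exact setIntegral_mono_set (integrableOn_box b (hp.continuous.pow 2).continuousOn)
      (Eventually.of_forall fun y => sq_nonneg _) hbox.eventuallyLE
  have hlam_b := hp.sineEigenvalue_le ⟨x, hxU⟩ hb hUb
  have hlam_a := hp.le_sineEigenvalue ha haU
  have hL0 := hb j
  have hdiff : (sineEigenvalue a 1 - sineEigenvalue b 1) * b j ^ 2 ≤ K := by
    rw [sineEigenvalue_one_eq, sineEigenvalue_one_eq, ← mul_sub, ← Finset.sum_sub_distrib]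
    have h1 : ∑ i, (1 / a i ^ 2 - 1 / b i ^ 2) ≤ n * (C₁ / b j ^ 2) := by
      refine (Finset.sum_le_sum fun i _ => hgap i j).trans (le_of_eq ?_)
      simp
    calc _ ≤ π ^ 2 / 4 * (n * (C₁ / b j ^ 2)) * b j ^ 2 := by gcongr
      _ = K := by rw [hK]; field_simp
  have hupper : ∀ y ∈ U, p y ≤ H / sqrt (∏ i, b i) * sineMode b 1 y := by
    intro y hy
    have h1 := hp.exp_mul_le hb hUb hp1.le one_pos hj hy
    have hs0 := sineMode_one_pos hb (hUb hy)
    have h2 : exp (-sineEigenvalue b 1 * (1 * b j ^ 2)) ≤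
        exp K * exp (-lam * (1 * b j ^ 2)) := by
      rw [← exp_add, exp_le_exp]
      nlinarith [sq_nonneg (b j)]
    have h3 : exp (-lam * (1 * b j ^ 2)) * p y ≤
        exp (-lam * (1 * b j ^ 2)) * (H / sqrt (∏ i, b i) * sineMode b 1 y) := by
      calc _ ≤ _ := h1
        _ ≤ 2 ^ n * (1 + 4 / 1 ^ 2) ^ n / sqrt (∏ i, b i) *
            (exp K * exp (-lam * (1 * b j ^ 2)) * sineMode b 1 y) := by gcongr
        _ = _ := by
          rw [← mul_pow, hH]
          norm_num
          ring
    exact le_of_mul_le_mul_left h3 (exp_pos _)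
  have hPa : 0 < ∏ i, a i := Finset.prod_pos fun i _ => ha i
  have hκa : 0 < sqrt (∏ i, a i) := sqrt_pos.2 hPa
  have hκab : sqrt (∏ i, a i) ≤ sqrt (∏ i, b i) :=
    sqrt_le_sqrt (Finset.prod_le_prod (fun i _ => (ha i).le) fun i _ => hab i)
  have hs0 := sineMode_one_pos ha hxa
  constructor
  · have hpH : ∀ y ∈ box n b, p y ≤ H / sqrt (∏ i, b i) := by
      intro y _
      by_cases hyU : y ∈ U
      · exact (hupper y hyU).trans
          (mul_le_of_le_one_right (by positivity) ((le_abs_self _).trans (abs_sineMode_le_one _ _ _)))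
      · rw [hp.eq_zero y hyU]
        positivity
    have hmass := hp.le_setIntegral_mul_sineMode_sq ha hb hab hH0 hηI hba hHη hpH hp1
    have h1 := hp.le_exp_mul ha haU hp1a hA (fun i => (hab i).trans (hj i)) hxa
    have h2 : c₀ / 2 / sqrt (∏ i, a i) ≤ (∫ y in box n a, p y * sineMode a 1 y ^ 2) / (∏ i, a i) -
        2 ^ n * ((1 + 4 / A ^ 2) ^ n - 1) / sqrt (∏ i, a i) := by
      have e1 : c₀ / sqrt (∏ i, a i) ≤
          (∫ y in box n a, p y * sineMode a 1 y ^ 2) / (∏ i, a i) := by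
        rw [le_div_iff₀ hPa, div_mul_eq_mul_div, mul_div_assoc, div_sqrt]
        exact hmass
      have e2 : 2 ^ n * ((1 + 4 / A ^ 2) ^ n - 1) / sqrt (∏ i, a i) ≤
          c₀ / 2 / sqrt (∏ i, a i) := by gcongr
      have e3 : c₀ / 2 / sqrt (∏ i, a i) = c₀ / sqrt (∏ i, a i) - c₀ / 2 / sqrt (∏ i, a i) := by
        ring
      linarith
    have h3 : exp (-lam * (A * b j ^ 2)) * exp (-(A * K)) ≤
        exp (-sineEigenvalue a 1 * (A * b j ^ 2)) := by
      rw [← exp_add, exp_le_exp]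
      have e1 : (sineEigenvalue a 1 - lam) * b j ^ 2 ≤ K := by
        refine le_trans ?_ hdiff
        gcongr
      nlinarith [mul_le_mul_of_nonneg_left e1 hA.le]
    have h4 : exp (-lam * (A * b j ^ 2)) *
        (exp (-(A * K)) * (c₀ / 2) * (sineMode a 1 x / sqrt (∏ i, a i))) ≤
        exp (-lam * (A * b j ^ 2)) * p x := by
      calc _ = c₀ / 2 / sqrt (∏ i, a i) *
            (exp (-lam * (A * b j ^ 2)) * exp (-(A * K)) * sineMode a 1 x) := by ring
        _ ≤ c₀ / 2 / sqrt (∏ i, a i) *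
            (exp (-sineEigenvalue a 1 * (A * b j ^ 2)) * sineMode a 1 x) := by gcongr
        _ ≤ _ := by gcongr
        _ ≤ _ := h1
    exact le_of_mul_le_mul_left h4 (exp_pos _)
  · calc p x ≤ H / sqrt (∏ i, b i) * sineMode b 1 x := hupper x hxU
      _ ≤ H / sqrt (∏ i, a i) * (π ^ n * sineMode a 1 x) := by
          have := sineMode_one_le_of_abs_lt ha hab hx
          gcongr
          exact sineMode_one_nonneg hb fun i => (box_subset_closedBox b (hUb hxU)) i
      _ = H * π ^ n * (sineMode a 1 x / sqrt (∏ i, a i)) := by ring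
end

section
/- There exists an absolute constant C > 0 such that for every a > 0, every t > 0, and all x, y ∈ (−a,a): | e^{(π/(2a))² t}·p_a(t,x,y)/(φ(x)·φ(y)) − 1 | ≤ C·(a/√t)³, where p_a is the Dirichlet heat kernel of the interval (−a,a) and φ(x) = a^{−1/2} cos(π x/(2a)). -/
open Real MeasureTheory

/-- The Dirichlet heat kernel of the interval `(-a, a)`. -/
noncomputable def intervalHeatKernel (a t x y : ℝ) : ℝ :=
  ∑' j : ℕ, Real.exp (-((((j : ℝ) + 1) * π / (2 * a)) ^ 2) * t) *
    ((1 / a) * Real.sin (((j : ℝ) + 1) * π * (x + a) / (2 * a)) *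
      Real.sin (((j : ℝ) + 1) * π * (y + a) / (2 * a)))

/-- The first eigenfunction dominates all others: `|sin (nθ)| ≤ n |sin θ|`. -/
lemma abs_sin_nat_mul_le_mul_abs_sin (n : ℕ) (θ : ℝ) :
    |Real.sin (n * θ)| ≤ n * |Real.sin θ| := by
  induction n with
  | zero => simp
  | succ n ih =>
    push_cast
    rw [add_mul, one_mul, Real.sin_add]
    calc |Real.sin (n * θ) * Real.cos θ + Real.cos (n * θ) * Real.sin θ|
        ≤ |Real.sin (n * θ)| * |Real.cos θ| + |Real.cos (n * θ)| * |Real.sin θ| := by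
          simpa only [abs_mul] using
            abs_add_le (Real.sin (n * θ) * Real.cos θ) (Real.cos (n * θ) * Real.sin θ)
      _ ≤ |Real.sin (n * θ)| * 1 + 1 * |Real.sin θ| := by
          gcongr <;> apply_rules [Real.abs_cos_le_one]
      _ ≤ (n + 1) * |Real.sin θ| := by linarith

lemma sq_mul_exp_mul_one_add_sq_le (u : ℝ) :
    u ^ 2 * Real.exp (-(3 / 4 * u ^ 2)) * (1 + u) ^ 2 ≤ 8 := by
  have h := Real.quadratic_le_exp_of_nonneg (x := 3 / 4 * u ^ 2) (by positivity)
  rw [Real.exp_neg, mul_right_comm, ← div_eq_mul_inv, div_le_iff₀ (Real.exp_pos _)]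
  have h1 : (1 + u) ^ 2 ≤ 2 * (1 + u ^ 2) := by nlinarith [sq_nonneg (u - 1)]
  have h2 := mul_le_mul_of_nonneg_left h1 (sq_nonneg u)
  nlinarith [sq_nonneg u, sq_nonneg (u ^ 2)]

/-- A Gaussian tail term is dominated by a telescoping difference. -/
lemma sq_mul_exp_le_telescoping {h : ℝ} (hh : 0 < h) (n : ℕ) :
    ((n : ℝ) + 2) ^ 2 * Real.exp (-((((n : ℝ) + 2) ^ 2 - 1) * h ^ 2)) ≤
      8 / h ^ 3 * (1 / (1 + ((n : ℝ) + 1) * h) - 1 / (1 + ((n + 1 : ℕ) + 1 : ℝ) * h)) := by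
  have hn : (0 : ℝ) ≤ n := n.cast_nonneg
  set u := ((n : ℝ) + 2) * h with hu_def
  have hu : 0 < u := by positivity
  have hle : Real.exp (-((((n : ℝ) + 2) ^ 2 - 1) * h ^ 2)) ≤ Real.exp (-(3 / 4 * u ^ 2)) := by
    apply Real.exp_le_exp.2
    have : 0 ≤ (n : ℝ) ^ 2 * h ^ 2 := by positivity
    have : 0 ≤ (n : ℝ) * h ^ 2 := by positivity
    rw [hu_def]
    nlinarith
  have hdiff : 1 / (1 + ((n : ℝ) + 1) * h) - 1 / (1 + ((n + 1 : ℕ) + 1 : ℝ) * h) =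
      h / ((1 + ((n : ℝ) + 1) * h) * (1 + u)) := by
    rw [hu_def]; push_cast
    have : (1 + ((n : ℝ) + 1) * h) ≠ 0 := by positivity
    have : (1 + ((n : ℝ) + 1 + 1) * h) ≠ 0 := by positivity
    have : (1 + ((n : ℝ) + 2) * h) ≠ 0 := by positivity
    field_simp
    ring
  have hsq : h / (1 + u) ^ 2 ≤ h / ((1 + ((n : ℝ) + 1) * h) * (1 + u)) := by
    rw [sq]
    gcongr
    rw [hu_def]
    nlinarith
  rw [hdiff]
  calc ((n : ℝ) + 2) ^ 2 * Real.exp (-((((n : ℝ) + 2) ^ 2 - 1) * h ^ 2))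
      ≤ ((n : ℝ) + 2) ^ 2 * Real.exp (-(3 / 4 * u ^ 2)) := by gcongr
    _ = (u ^ 2 * Real.exp (-(3 / 4 * u ^ 2)) * (1 + u) ^ 2) / h ^ 3 * (h / (1 + u) ^ 2) := by
        rw [hu_def]; field_simp
    _ ≤ 8 / h ^ 3 * (h / (1 + u) ^ 2) := by
        gcongr; exact sq_mul_exp_mul_one_add_sq_le u
    _ ≤ _ := by gcongr

lemma sum_range_sq_mul_exp_le {h : ℝ} (hh : 0 < h) (N : ℕ) :
    ∑ n ∈ Finset.range N,
      ((n : ℝ) + 2) ^ 2 * Real.exp (-((((n : ℝ) + 2) ^ 2 - 1) * h ^ 2)) ≤ 8 / h ^ 3 := by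
  refine (Finset.sum_le_sum fun n _ => sq_mul_exp_le_telescoping hh n).trans ?_
  rw [← Finset.mul_sum, Finset.sum_range_sub' (fun n : ℕ => 1 / (1 + ((n : ℝ) + 1) * h))]
  apply mul_le_of_le_one_right (by positivity)
  have h1 : 1 / (1 + (((0 : ℕ) : ℝ) + 1) * h) ≤ 1 := by
    rw [div_le_one (by positivity)]; simp [hh.le]
  have h2 : 0 ≤ 1 / (1 + ((N : ℝ) + 1) * h) := by positivity
  linarith

/-- The Dirichlet eigenfunction series on `(0, π)`, normalized by its first term, is
`1 + O(h⁻³)`. -/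
lemma abs_tsum_exp_mul_sin_div_sub_one_le {h θ η : ℝ} (hh : 0 < h) (hθ : Real.sin θ ≠ 0)
    (hη : Real.sin η ≠ 0) :
    |∑' j : ℕ, Real.exp (-((((j : ℝ) + 1) ^ 2 - 1) * h ^ 2)) *
      (Real.sin (((j : ℝ) + 1) * θ) / Real.sin θ) *
      (Real.sin (((j : ℝ) + 1) * η) / Real.sin η) - 1| ≤ 8 / h ^ 3 := by
  set f : ℕ → ℝ := fun j => Real.exp (-((((j : ℝ) + 1) ^ 2 - 1) * h ^ 2)) *
      (Real.sin (((j : ℝ) + 1) * θ) / Real.sin θ) *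
      (Real.sin (((j : ℝ) + 1) * η) / Real.sin η)
  have hsin (j : ℕ) {ζ : ℝ} (hζ : Real.sin ζ ≠ 0) :
      |Real.sin (((j : ℝ) + 1) * ζ) / Real.sin ζ| ≤ j + 1 := by
    rw [abs_div, div_le_iff₀ (abs_pos.2 hζ)]
    exact_mod_cast abs_sin_nat_mul_le_mul_abs_sin (j + 1) ζ
  have hbound (n : ℕ) : ‖f (n + 1)‖ ≤
      ((n : ℝ) + 2) ^ 2 * Real.exp (-((((n : ℝ) + 2) ^ 2 - 1) * h ^ 2)) := by
    have h1 := hsin (n + 1) hθ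
    have h2 := hsin (n + 1) hη
    have e : ((n + 1 : ℕ) : ℝ) + 1 = n + 2 := by push_cast; ring
    simp only [f, Real.norm_eq_abs, abs_mul, Real.abs_exp]
    rw [e] at h1 h2 ⊢
    calc _ ≤ Real.exp (-((((n : ℝ) + 2) ^ 2 - 1) * h ^ 2)) * (n + 2) * (n + 2) := by gcongr
      _ = _ := by ring
  have hpartial (N : ℕ) : ∑ n ∈ Finset.range N, ‖f (n + 1)‖ ≤ 8 / h ^ 3 :=
    (Finset.sum_le_sum fun n _ => hbound n).trans (sum_range_sq_mul_exp_le hh N)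
  have hnorm : Summable fun n => ‖f (n + 1)‖ :=
    summable_of_sum_range_le (fun _ => norm_nonneg _) hpartial
  have hf : Summable f := (summable_nat_add_iff 1).1 hnorm.of_norm
  have hf0 : f 0 = 1 := by simp [f, hθ, hη]
  rw [hf.tsum_eq_zero_add, hf0, add_sub_cancel_left]
  exact (norm_tsum_le_tsum_norm hnorm).trans
    (Real.tsum_le_of_sum_range_le (fun _ => norm_nonneg _) hpartial)

theorem stmt_15 :
    ∃ C > (0 : ℝ), ∀ a : ℝ, 0 < a → ∀ t : ℝ, 0 < t →
      ∀ x ∈ Set.Ioo (-a) a, ∀ y ∈ Set.Ioo (-a) a,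
        |Real.exp ((π / (2 * a)) ^ 2 * t) * intervalHeatKernel a t x y /
              ((1 / Real.sqrt a * Real.cos (π * x / (2 * a))) *
                (1 / Real.sqrt a * Real.cos (π * y / (2 * a)))) - 1| ≤
          C * (a / Real.sqrt t) ^ 3 := by
  refine ⟨64 / π ^ 3, by positivity, fun a ha t ht x hx y hy => ?_⟩
  have hcos {z : ℝ} (hz : z ∈ Set.Ioo (-a) a) : 0 < Real.cos (π * z / (2 * a)) := by
    apply Real.cos_pos_of_mem_Ioo
    constructor
    · rw [lt_div_iff₀ (by positivity)]; nlinarith [hz.1, Real.pi_pos]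
    · rw [div_lt_iff₀ (by positivity)]; nlinarith [hz.2, Real.pi_pos]
  have hsin (z : ℝ) : Real.sin (π * (z + a) / (2 * a)) = Real.cos (π * z / (2 * a)) := by
    rw [← Real.sin_add_pi_div_two]; congr 1; field_simp
  set h := π / (2 * a) * √t with h_def
  have hh : 0 < h := by positivity
  have hsq : h ^ 2 = (π / (2 * a)) ^ 2 * t := by rw [h_def, mul_pow, Real.sq_sqrt ht.le]
  have key := abs_tsum_exp_mul_sin_div_sub_one_le hh
    (θ := π * (x + a) / (2 * a)) (η := π * (y + a) / (2 * a))
    (by rw [hsin]; exact (hcos hx).ne') (by rw [hsin]; exact (hcos hy).ne')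
  convert key using 1
  · congr 2
    rw [intervalHeatKernel, ← tsum_mul_left, ← tsum_div_const]
    refine tsum_congr fun j => ?_
    have hexp : Real.exp (-((((j : ℝ) + 1) ^ 2 - 1) * h ^ 2)) =
        Real.exp ((π / (2 * a)) ^ 2 * t) *
          Real.exp (-((((j : ℝ) + 1) * π / (2 * a)) ^ 2) * t) := by
      rw [← Real.exp_add, hsq]; congr 1; ring
    have hs : √a * √a = a := Real.mul_self_sqrt ha.le
    have hden : 1 / √a * Real.cos (π * x / (2 * a)) * (1 / √a * Real.cos (π * y / (2 * a))) =
        1 / a * (Real.cos (π * x / (2 * a)) * Real.cos (π * y / (2 * a))) := by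
      rw [← hs]
      have : √a ≠ 0 := by positivity
      simp only [Real.sqrt_mul_self (Real.sqrt_nonneg a)]
      field_simp
    have hx0 := (hcos hx).ne'
    have hy0 := (hcos hy).ne'
    rw [hexp, hsin, hsin, hden, mul_assoc _ π (x + a), mul_assoc _ π (y + a),
      mul_div_assoc _ (π * (x + a)), mul_div_assoc _ (π * (y + a))]
    generalize Real.cos (π * x / (2 * a)) = c at *
    generalize Real.cos (π * y / (2 * a)) = d at *
    field_simp
  · rw [h_def]
    field_simp
    norm_num
end
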